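/- Let Λ_Φ be a Barański sponge, λ ≥ 1, and r an exponentially λ-periodic cycle. If r is nondegenerate, then HD(ν_r) = δ(r) := inf_{B∈[1,λ]} δ(r,B), where δ(r,B) = (1/B)∫_0^∞ h({i ∈ D : b ≤ B_i}; r_b) db and B_1,…,B_d > 0 are determined by B = ∫_0^{B_i} χ_i(r_b) db. If r is degenerate, then HD(ν_r) ≤ δ(r). In particular, for every p ∈ P, HD(ν_p) = δ(p) := ∫_0^∞ h({i ∈ D : b ≤ 1/χ_i(p)}; p) db. -/

import Mathlib

open MeasureTheory Filter Set Metric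
open scoped Classical Topology ENNReal NNReal

namespace SelfAffineSponge

/-- A diagonal IFS on `[0,1]^d`: for each coordinate `i ∈ D = Fin d` a finite alphabet
`A i` indexing affine maps `x ↦ slope i a * x + off i a` of `[0,1]`, together with a
set `E ⊆ ∏ i, A i` of allowed tuples of symbols. -/
structure DiagIFS (d : ℕ) (A : Fin d → Type) [∀ i, Fintype (A i)] where
  slope : ∀ i : Fin d, A i → ℝ
  off : ∀ i : Fin d, A i → ℝ
  E : Finset (∀ i, A i)

variable {d : ℕ} {A : Fin d → Type} [∀ i, Fintype (A i)]

namespace DiagIFS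

/-- the base similarity `φ_{i,a}` in coordinate `i` -/
def base (Φ : DiagIFS d A) (i : Fin d) (a : A i) (x : ℝ) : ℝ :=
  Φ.slope i a * x + Φ.off i a

/-- the data defines an honest diagonal IFS: `E` is nonempty and each base map is a
contracting similarity of `[0,1]` -/
def Valid (Φ : DiagIFS d A) : Prop :=
  Φ.E.Nonempty ∧ (∀ i a, Φ.slope i a ≠ 0) ∧ (∀ i a, |Φ.slope i a| < 1) ∧
    ∀ i a, ∀ x ∈ Set.Icc (0:ℝ) 1, Φ.base i a x ∈ Set.Icc (0:ℝ) 1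

/-- the alphabet `E` of the IFS, as a type -/
abbrev Symb (Φ : DiagIFS d A) : Type _ := {a : ∀ i, A i // a ∈ Φ.E}

instance (Φ : DiagIFS d A) : MeasurableSpace Φ.Symb := ⊤
instance (Φ : DiagIFS d A) : TopologicalSpace Φ.Symb := ⊥

/-- the affine contraction `φ_a` of `[0,1]^d` associated to a tuple of symbols -/
def affMap (Φ : DiagIFS d A) (a : ∀ i, A i) (x : Fin d → ℝ) : Fin d → ℝ :=
  fun i => Φ.base i (a i) (x i)

/-- the coding map `π(ω) = lim_n φ_{ω_0}∘⋯∘φ_{ω_{n-1}}(0)`, written in closed form -/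
noncomputable def coding (Φ : DiagIFS d A) (ω : ℕ → Φ.Symb) : Fin d → ℝ :=
  fun i => ∑' n : ℕ, (∏ k ∈ Finset.range n, Φ.slope i ((ω k).1 i)) * Φ.off i ((ω n).1 i)

/-- the limit set `Λ_Φ = π(E^ℕ)` (the self-affine sponge) -/
def limitSet (Φ : DiagIFS d A) : Set (Fin d → ℝ) :=
  Set.range Φ.coding

theorem coding_mem (Φ : DiagIFS d A) (ω : ℕ → Φ.Symb) : Φ.coding ω ∈ Φ.limitSet :=
  ⟨ω, rfl⟩

/-- the `i`-th Lyapunov exponent `χ_i(p) = -∫ log|φ'_{a,i}| dp(a)` of a finite measure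
`p` on `E` (given by its density) -/
noncomputable def chi (Φ : DiagIFS d A) (i : Fin d) (p : Φ.Symb → ℝ) : ℝ :=
  -∑ a : Φ.Symb, p a * Real.log |Φ.slope i (a.1 i)|

/-- the mass `p([a]_I)` of the cylinder `[a]_I = {b ∈ E : b_i = a_i ∀ i ∈ I}` -/
noncomputable def cylMass (Φ : DiagIFS d A) (I : Finset (Fin d)) (p : Φ.Symb → ℝ)
    (a : Φ.Symb) : ℝ :=
  ∑ b : Φ.Symb, if ∀ i ∈ I, b.1 i = a.1 i then p b else 0

/-- the entropy `h(I; p) = -∫ log p([a]_I) dp(a)` -/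
noncomputable def entropy (Φ : DiagIFS d A) (I : Finset (Fin d)) (p : Φ.Symb → ℝ) : ℝ :=
  -∑ a : Φ.Symb, p a * Real.log (Φ.cylMass I p a)

/-- the conditional entropy `h(I' | I; p) = h(I';p) - h(I;p)` -/
noncomputable def condEntropy (Φ : DiagIFS d A) (I I' : Finset (Fin d))
    (p : Φ.Symb → ℝ) : ℝ :=
  Φ.entropy I' p - Φ.entropy I p

/-- a coordinate set `I ⊆ D` is good if the projected IFS `Φ_I` satisfies the open set
condition: the boxes `φ_{I,a}((0,1)^I)`, indexed by distinct projections of elements of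
`E`, are pairwise disjoint (equivalently, some coordinate has disjoint intervals). -/
def GoodIdx (Φ : DiagIFS d A) (I : Finset (Fin d)) : Prop :=
  ∀ a ∈ Φ.E, ∀ b ∈ Φ.E, (∃ i ∈ I, a i ≠ b i) →
    ∃ i ∈ I, Disjoint (Φ.base i (a i) '' Set.Ioo (0:ℝ) 1)
      (Φ.base i (b i) '' Set.Ioo (0:ℝ) 1)

/-- Barański condition: each base IFS satisfies the open set condition w.r.t. `(0,1)` -/
def Baranski (Φ : DiagIFS d A) : Prop :=
  ∀ i : Fin d, ∀ a b : A i, a ≠ b →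
    Disjoint (Φ.base i a '' Set.Ioo (0:ℝ) 1) (Φ.base i b '' Set.Ioo (0:ℝ) 1)

/-- strong Barański condition: each base IFS satisfies the strong separation condition
w.r.t. `[0,1]` -/
def StronglyBaranski (Φ : DiagIFS d A) : Prop :=
  ∀ i : Fin d, ∀ a b : A i, a ≠ b →
    Disjoint (Φ.base i a '' Set.Icc (0:ℝ) 1) (Φ.base i b '' Set.Icc (0:ℝ) 1)

/-- coordinate ordering condition: some permutation `σ` of the coordinates has
`|φ'_{a,σ(1)}| > ⋯ > |φ'_{a,σ(d)}|` for all `a ∈ E` -/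
def CoordOrdering (Φ : DiagIFS d A) : Prop :=
  ∃ σ : Equiv.Perm (Fin d), ∀ a ∈ Φ.E, ∀ i j : Fin d, i < j →
    |Φ.slope (σ j) (a (σ j))| < |Φ.slope (σ i) (a (σ i))|

end DiagIFS

/-- a probability vector (probability measure on a finite set, via its density) -/
def IsProbVec {α : Type*} [Fintype α] (p : α → ℝ) : Prop :=
  (∀ a, 0 ≤ p a) ∧ ∑ a, p a = 1

/-- a measure `p` on `E` is good if `I(p,x) = {i : χ_i(p) ≤ x}` is good for all `x > 0` -/
def DiagIFS.GoodVec (Φ : DiagIFS d A) (p : Φ.Symb → ℝ) : Prop :=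
  ∀ x > 0, Φ.GoodIdx (Finset.univ.filter fun i => Φ.chi i p ≤ x)

/-- a cycle on `E`: a continuous exponentially `λ`-periodic map `(0,∞) → P`,
where `λ = 1` means constant -/
structure Cycle (Φ : DiagIFS d A) where
  lam : ℝ
  one_le_lam : 1 ≤ lam
  r : ℝ → Φ.Symb → ℝ
  prob : ∀ b > 0, IsProbVec (r b)
  cont : ContinuousOn r (Set.Ioi 0)
  periodic : ∀ b > 0, r (lam * b) = r b
  const_of_lam_eq_one : lam = 1 → ∀ b > 0, ∀ b' > 0, r b = r b'

/-- the number `B_i`, determined by `B = ∫_0^{B_i} χ_i(r_b) db` (written via `sInf`;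
for a cycle the function `x ↦ ∫_0^x χ_i(r_b) db` is continuous and strictly
increasing, so the infimum is the unique solution) -/
noncomputable def Bcoord (Φ : DiagIFS d A) (r : ℝ → Φ.Symb → ℝ) (B : ℝ) (i : Fin d) : ℝ :=
  sInf {x : ℝ | 0 ≤ x ∧ B ≤ ∫ b in Set.Ioc (0:ℝ) x, Φ.chi i (r b)}

/-- `δ(r, B) = B⁻¹ ∫_0^∞ h({i : b ≤ B_i}; r_b) db` -/
noncomputable def deltaRB (Φ : DiagIFS d A) (r : ℝ → Φ.Symb → ℝ) (B : ℝ) : ℝ :=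
  B⁻¹ * ∫ b in Set.Ioi (0:ℝ),
    Φ.entropy (Finset.univ.filter fun i => b ≤ Bcoord Φ r B i) (r b)

/-- `δ(r) = inf_{B ∈ [1,λ]} δ(r,B)` -/
noncomputable def Cycle.delta {Φ : DiagIFS d A} (c : Cycle Φ) : ℝ :=
  sInf (deltaRB Φ c.r '' Set.Icc 1 c.lam)

/-- `δ(p) = ∫_0^∞ h({i : b ≤ 1/χ_i(p)}; p) db` -/
noncomputable def deltaP (Φ : DiagIFS d A) (p : Φ.Symb → ℝ) : ℝ :=
  ∫ b in Set.Ioi (0:ℝ),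
    Φ.entropy (Finset.univ.filter fun i => b ≤ (Φ.chi i p)⁻¹) p

/-- the normalized average `R̂_B = B⁻¹ ∫_0^B r_b db` of a cycle -/
noncomputable def cycleAvg {Φ : DiagIFS d A} (c : Cycle Φ) (B : ℝ) : Φ.Symb → ℝ :=
  fun a => B⁻¹ * ∫ b in Set.Ioc (0:ℝ) B, c.r b a

/-- a cycle is good if all its normalized averages `R̂_B` are good -/
def Cycle.Good {Φ : DiagIFS d A} (c : Cycle Φ) : Prop :=
  ∀ B > 0, Φ.GoodVec (cycleAvg c B)

/-- a cycle is nondegenerate if `{b > 0 : r_b(a) > 0 ∀ a ∈ E_r}` is dense in `(0,∞)` -/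
def Cycle.Nondeg {Φ : DiagIFS d A} (c : Cycle Φ) : Prop :=
  Set.Ioi (0:ℝ) ⊆
    closure {b : ℝ | 0 < b ∧ ∀ a : Φ.Symb, (∃ b' > 0, 0 < c.r b' a) → 0 < c.r b a}

/-- the lower pointwise dimension `d̲(x,μ) = liminf_{ρ→0} log μ(B(x,ρ))/log ρ` -/
noncomputable def lowerPtDim {X : Type*} [PseudoMetricSpace X] [MeasurableSpace X]
    (μ : Measure X) (x : X) : ℝ≥0∞ :=
  Filter.liminf
    (fun ρ : ℝ => ENNReal.ofReal (Real.log (μ (Metric.ball x ρ)).toReal / Real.log ρ))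
    (𝓝[>] (0:ℝ))

/-- the Hausdorff dimension of a measure: the essential supremum of its lower
pointwise dimension -/
noncomputable def measDim {X : Type*} [PseudoMetricSpace X] [MeasurableSpace X]
    (μ : Measure X) : ℝ≥0∞ :=
  essSup (lowerPtDim μ) μ

/-- the shift map on `E^ℕ` -/
def shift {α : Type*} (ω : ℕ → α) : ℕ → α := fun n => ω (n + 1)

/-- the dynamical dimension: the supremum of `HD(π_*μ)` over shift-invariant
probability measures `μ` on `E^ℕ` -/
noncomputable def DiagIFS.dynDim (Φ : DiagIFS d A) : ℝ≥0∞ :=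
  sSup {x : ℝ≥0∞ | ∃ μ : Measure (ℕ → Φ.Symb), IsProbabilityMeasure μ ∧
    Measure.map shift μ = μ ∧ x = measDim (Measure.map Φ.coding μ)}

/-- `μ` is the product measure on `E^ℕ` whose `k`-th factor has density `p k`
(this property characterizes `μ` uniquely) -/
def IsProductMeasure (Φ : DiagIFS d A) (p : ℕ → Φ.Symb → ℝ)
    (μ : Measure (ℕ → Φ.Symb)) : Prop :=
  IsProbabilityMeasure μ ∧
    ∀ (n : ℕ) (w : ℕ → Φ.Symb),
      (μ {ω | ∀ k < n, ω k = w k}).toReal = ∏ k ∈ Finset.range n, p k (w k)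

/-- the set of Hausdorff dimensions of Bernoulli measures `ν_p = π_*[p^ℕ]` -/
noncomputable def bernoulliDims (Φ : DiagIFS d A) : Set ℝ≥0∞ :=
  {x | ∃ p : Φ.Symb → ℝ, IsProbVec p ∧ ∃ μ : Measure (ℕ → Φ.Symb),
    IsProductMeasure Φ (fun _ => p) μ ∧ x = measDim (Measure.map Φ.coding μ)}

/-- the set of Hausdorff dimensions of pseudo-Bernoulli measures
`ν_r = π_*[∏_n r_n]` -/
noncomputable def pseudoBernoulliDims (Φ : DiagIFS d A) : Set ℝ≥0∞ :=
  {x | ∃ c : Cycle Φ, ∃ μ : Measure (ℕ → Φ.Symb),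
    IsProductMeasure Φ (fun n => c.r ((n : ℝ) + 1)) μ ∧
      x = measDim (Measure.map Φ.coding μ)}

instance (Φ : DiagIFS d A) : DiscreteTopology Φ.Symb := ⟨rfl⟩

instance (Φ : DiagIFS d A) : DiscreteMeasurableSpace Φ.Symb := ⟨fun _ => trivial⟩

namespace IsProductMeasure

variable {Φ : DiagIFS d A} {q : ℕ → Φ.Symb → ℝ} {μ : Measure (ℕ → Φ.Symb)}

theorem measurableSet_box (J : Finset ℕ) (S : ℕ → Finset Φ.Symb) :
    MeasurableSet {ω : ℕ → Φ.Symb | ∀ k ∈ J, ω k ∈ S k} := by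
  have : {ω : ℕ → Φ.Symb | ∀ k ∈ J, ω k ∈ S k}
      = ⋂ k ∈ J, (fun ω : ℕ → Φ.Symb => ω k) ⁻¹' (S k : Set Φ.Symb) := by
    ext ω; simp
  rw [this]
  exact Finset.measurableSet_biInter _ fun k _ =>
    (measurable_pi_apply k) (MeasurableSet.of_discrete)

theorem real_initial_box (hμ : IsProductMeasure Φ q μ) (n : ℕ) (S : ℕ → Finset Φ.Symb) :
    μ.real {ω | ∀ k ∈ Finset.range n, ω k ∈ S k}
      = ∏ k ∈ Finset.range n, ∑ a ∈ S k, q k a := by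
  have := hμ.1
  obtain ⟨ω₀⟩ : Nonempty (ℕ → Φ.Symb) := nonempty_of_isProbabilityMeasure μ
  let ext : (Fin n → Φ.Symb) → ℕ → Φ.Symb := fun w k => if h : k < n then w ⟨k, h⟩ else ω₀ k
  have hext : ∀ (w : Fin n → Φ.Symb) (k : Fin n), ext w k = w k := by
    intro w k; simp [ext]
  have hset : {ω : ℕ → Φ.Symb | ∀ k ∈ Finset.range n, ω k ∈ S k}
      = ⋃ w ∈ Fintype.piFinset (fun k : Fin n => S k), {ω | ∀ k < n, ω k = ext w k} := by
    ext ω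
    simp only [Finset.mem_range, mem_ofPred_eq, Fintype.mem_piFinset, mem_iUnion, exists_prop]
    constructor
    · intro h
      refine ⟨fun k => ω k, fun k => h k k.2, fun k hk => ?_⟩
      simp [ext, hk]
    · rintro ⟨w, hw, h⟩ k hk
      rw [h k hk]
      simpa [ext, hk] using hw ⟨k, hk⟩
  rw [hset, measureReal_biUnion_finset]
  · rw [← Fin.prod_univ_eq_prod_range (fun k => ∑ a ∈ S k, q k a), Finset.prod_univ_sum]
    refine Finset.sum_congr rfl fun w _ => ?_
    rw [measureReal_def, hμ.2 n (ext w), ← Fin.prod_univ_eq_prod_range]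
    exact Finset.prod_congr rfl fun k _ => by rw [hext]
  · intro w _ w' _ hne
    refine Set.disjoint_left.2 fun ω h h' => hne ?_
    funext k
    rw [← hext w k, ← hext w' k, ← h k k.2, h' k k.2]
  · intro w _
    have := measurableSet_box (Finset.range n) (fun k => ({ext w k} : Finset Φ.Symb))
    simpa using this

/-- A product measure of a box with finitely many constrained coordinates. -/
theorem real_box (hμ : IsProductMeasure Φ q μ) (hq : ∀ n, IsProbVec (q n)) (J : Finset ℕ)
    (S : ℕ → Finset Φ.Symb) :
    μ.real {ω | ∀ k ∈ J, ω k ∈ S k} = ∏ k ∈ J, ∑ a ∈ S k, q k a := by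
  obtain ⟨n, hn⟩ := J.exists_nat_subset_range
  have h := hμ.real_initial_box n (fun k => if k ∈ J then S k else Finset.univ)
  rw [← Finset.prod_subset hn] at h
  · rw [show {ω : ℕ → Φ.Symb | ∀ k ∈ J, ω k ∈ S k} =
      {ω | ∀ k ∈ Finset.range n, ω k ∈ (if k ∈ J then S k else Finset.univ)} from ?_, h]
    · exact Finset.prod_congr rfl fun k hk => by simp [hk]
    · ext ω
      simp only [mem_ofPred_eq]
      constructor
      · intro h k _
        by_cases hk : k ∈ J
        · simpa [hk] using h k hk
        · simp [hk]
      · intro h k hk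
        simpa [hk] using h k (hn hk)
  · intro k _ hk
    rw [if_neg hk]
    exact (hq k).2

theorem real_coord (hμ : IsProductMeasure Φ q μ) (hq : ∀ n, IsProbVec (q n)) (n : ℕ)
    (S : Set Φ.Symb) : μ.real ((fun ω => ω n) ⁻¹' S) = ∑ a ∈ S.toFinset, q n a := by
  have := hμ.real_box hq {n} (fun _ => S.toFinset)
  simp only [Finset.mem_singleton, forall_eq, mem_toFinset, Finset.prod_singleton] at this
  exact this

theorem indepFun_coord (hμ : IsProductMeasure Φ q μ) (hq : ∀ n, IsProbVec (q n)) {m n : ℕ}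
    (hmn : m ≠ n) :
    ProbabilityTheory.IndepFun (fun ω : ℕ → Φ.Symb => ω m) (fun ω => ω n) μ := by
  have := hμ.1
  rw [ProbabilityTheory.indepFun_iff_measure_inter_preimage_eq_mul]
  intro s t _ _
  have h := hμ.real_box hq {m, n} (fun k => if k = m then s.toFinset else t.toFinset)
  rw [Finset.prod_pair hmn] at h
  simp only [if_true, hmn.symm, if_false, ← hμ.real_coord hq] at h
  have h2 : {ω : ℕ → Φ.Symb | ∀ k ∈ ({m, n} : Finset ℕ),
      ω k ∈ (if k = m then s.toFinset else t.toFinset)}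
      = (fun ω : ℕ → Φ.Symb => ω m) ⁻¹' s ∩ (fun ω => ω n) ⁻¹' t := by
    ext ω
    simp [hmn.symm]
  rw [h2] at h
  rw [← ENNReal.toReal_eq_toReal_iff' (measure_ne_top _ _)
    (ENNReal.mul_ne_top (measure_ne_top _ _) (measure_ne_top _ _)), ENNReal.toReal_mul]
  exact h

theorem integral_coord (hμ : IsProductMeasure Φ q μ) (hq : ∀ n, IsProbVec (q n)) (n : ℕ)
    (f : Φ.Symb → ℝ) : ∫ ω, f (ω n) ∂μ = ∑ a, q n a * f a := by
  have := hμ.1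
  have hm : Measurable fun ω : ℕ → Φ.Symb => ω n := measurable_pi_apply n
  have h := integral_map (μ := μ) hm.aemeasurable (f := f)
    (Measurable.of_discrete.aestronglyMeasurable)
  rw [← h]
  have : IsProbabilityMeasure (μ.map fun ω => ω n) :=
    Measure.isProbabilityMeasure_map hm.aemeasurable
  rw [integral_fintype Integrable.of_finite]
  refine Finset.sum_congr rfl fun a _ => ?_
  rw [map_measureReal_apply hm (MeasurableSet.of_discrete), hμ.real_coord hq]
  simp

theorem memLp_coord (hμ : IsProductMeasure Φ q μ) (n : ℕ) (f : Φ.Symb → ℝ) (p : ℝ≥0∞) :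
    MemLp (fun ω => f (ω n)) p μ := by
  have := hμ.1
  obtain ⟨C, hC⟩ := (Set.finite_range fun a => ‖f a‖).bddAbove
  exact MemLp.of_bound ((Measurable.of_discrete.comp
    (measurable_pi_apply n)).aestronglyMeasurable) C
    (Eventually.of_forall fun ω => hC ⟨ω n, rfl⟩)

theorem ae_pos (hμ : IsProductMeasure Φ q μ) (hq : ∀ n, IsProbVec (q n)) :
    ∀ᵐ ω ∂μ, ∀ n, 0 < q n (ω n) := by
  have := hμ.1
  rw [ae_all_iff]
  intro n
  have h := hμ.real_coord hq n {a | ¬ 0 < q n a}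
  rw [Finset.sum_eq_zero, measureReal_eq_zero_iff] at h
  · exact h
  · intro a ha
    simp only [mem_toFinset, mem_ofPred_eq, not_lt] at ha
    exact le_antisymm ha ((hq n).1 a)

end IsProductMeasure

/-- Comparison of two monotone sequences along the squares controls it everywhere. -/
theorem tendsto_sub_div_of_tendsto_sq {s e : ℕ → ℝ} (hs : Monotone s) (he : Monotone e) {C : ℝ}
    (hC : ∀ n, e (n + 1) - e n ≤ C)
    (h : Tendsto (fun k : ℕ => (s (k ^ 2) - e (k ^ 2)) / (k : ℝ) ^ 2) atTop (𝓝 0)) :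
    Tendsto (fun N : ℕ => (s N - e N) / N) atTop (𝓝 0) := by
  have hinc : ∀ n j : ℕ, e (n + j) - e n ≤ C * j := by
    intro n j
    induction j with
    | zero => simp
    | succ j ih =>
      have := hC (n + j)
      rw [← add_assoc]; push_cast; linarith
  set w : ℕ → ℝ := fun k => (s (k ^ 2) - e (k ^ 2)) / (k : ℝ) ^ 2 with hw
  have hinv : Tendsto (fun k : ℕ => (k : ℝ)⁻¹) atTop (𝓝 0) := tendsto_inv_atTop_nhds_zero_nat
  have hg : Tendsto (fun k : ℕ => |w k| + |w (k + 1)| * (1 + (k : ℝ)⁻¹) ^ 2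
      + C * (2 * (k : ℝ)⁻¹ + (k : ℝ)⁻¹ ^ 2)) atTop (𝓝 0) := by
    have h1 := h.abs
    have h2 := (h.comp (tendsto_add_atTop_nat 1)).abs
    have h3 : Tendsto (fun k : ℕ => (1 + (k : ℝ)⁻¹) ^ 2) atTop (𝓝 ((1 + 0) ^ 2)) :=
      (tendsto_const_nhds.add hinv).pow 2
    have h4 : Tendsto (fun k : ℕ => C * (2 * (k : ℝ)⁻¹ + (k : ℝ)⁻¹ ^ 2)) atTop
        (𝓝 (C * (2 * 0 + 0 ^ 2))) :=
      tendsto_const_nhds.mul ((tendsto_const_nhds.mul hinv).add (hinv.pow 2))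
    have := (h1.add (h2.mul h3)).add h4
    simpa using this
  have hsqrt : Tendsto Nat.sqrt atTop atTop := by
    refine tendsto_atTop.2 fun b => ?_
    filter_upwards [eventually_ge_atTop (b * b)] with n hn
    exact Nat.le_sqrt.2 hn
  refine squeeze_zero_norm' ?_ (hg.comp hsqrt)
  filter_upwards [eventually_ge_atTop 1] with N hN
  set k := Nat.sqrt N with hk
  have hk1 : 1 ≤ k := Nat.le_sqrt.2 (by simpa using hN)
  have hkN : k ^ 2 ≤ N := by rw [pow_two]; exact Nat.sqrt_le N
  have hNk : N ≤ (k + 1) ^ 2 := by rw [pow_two]; exact (Nat.lt_succ_sqrt N).le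
  have hk0 : (0 : ℝ) < k := by exact_mod_cast hk1
  have hkN' : (k : ℝ) ^ 2 ≤ N := by exact_mod_cast hkN
  have hd := hinc (k ^ 2) (2 * k + 1)
  rw [show k ^ 2 + (2 * k + 1) = (k + 1) ^ 2 by ring] at hd
  push_cast at hd
  have e1 : s (k ^ 2) - e (k ^ 2) = w k * (k : ℝ) ^ 2 := by
    simp only [hw]; field_simp
  have e2 : s ((k + 1) ^ 2) - e ((k + 1) ^ 2) = w (k + 1) * ((k : ℝ) + 1) ^ 2 := by
    simp only [hw]; push_cast; field_simp
  have m1 := hs hkN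
  have m2 := hs hNk
  have m3 := he hkN
  have m4 := he hNk
  have b1 := neg_abs_le (w k)
  have b2 := le_abs_self (w (k + 1))
  have b3 : -(|w k| * (k : ℝ) ^ 2) ≤ w k * (k : ℝ) ^ 2 := by nlinarith [sq_nonneg (k : ℝ)]
  have b4 : w (k + 1) * ((k : ℝ) + 1) ^ 2 ≤ |w (k + 1)| * ((k : ℝ) + 1) ^ 2 := by
    nlinarith [sq_nonneg ((k : ℝ) + 1)]
  have p1 : 0 ≤ |w k| * (k : ℝ) ^ 2 := by positivity
  have p2 : 0 ≤ |w (k + 1)| * ((k : ℝ) + 1) ^ 2 := by positivity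
  have key : |s N - e N| ≤ |w k| * (k : ℝ) ^ 2 + |w (k + 1)| * ((k : ℝ) + 1) ^ 2
      + C * (2 * k + 1) := by
    rw [abs_le]
    constructor <;> linarith
  rw [Real.norm_eq_abs, abs_div, Nat.abs_cast]
  calc |s N - e N| / N ≤ |s N - e N| / (k : ℝ) ^ 2 := by gcongr
    _ ≤ (|w k| * (k : ℝ) ^ 2 + |w (k + 1)| * ((k : ℝ) + 1) ^ 2
      + C * (2 * k + 1)) / (k : ℝ) ^ 2 := by gcongr
    _ = _ := by simp only [Function.comp, ← hk]; field_simp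

namespace IsProductMeasure

variable {Φ : DiagIFS d A} {q : ℕ → Φ.Symb → ℝ} {μ : Measure (ℕ → Φ.Symb)}

/-- Strong law of large numbers for nonnegative functions of the coordinates with uniformly
bounded second moments. -/
theorem strong_law (hμ : IsProductMeasure Φ q μ) (hq : ∀ n, IsProbVec (q n))
    (f : ℕ → Φ.Symb → ℝ) (f0 : ∀ n a, 0 ≤ f n a) (C : ℝ)
    (hC : ∀ n, ∑ a, q n a * f n a ^ 2 ≤ C) :
    ∀ᵐ ω ∂μ, Tendsto (fun N : ℕ => (∑ n ∈ Finset.range N, f n (ω n)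
      - ∑ n ∈ Finset.range N, ∑ a, q n a * f n a) / N) atTop (𝓝 0) := by
  have := hμ.1
  set X : ℕ → (ℕ → Φ.Symb) → ℝ := fun n ω => f n (ω n) with hX
  set e : ℕ → ℝ := fun N => ∑ n ∈ Finset.range N, ∑ a, q n a * f n a with he
  have hLp : ∀ n, MemLp (X n) 2 μ := fun n => hμ.memLp_coord n (f n) 2
  have hmean : ∀ N, ∫ ω, (∑ n ∈ Finset.range N, X n) ω ∂μ = e N := by
    intro N
    simp only [Finset.sum_apply]
    rw [integral_finsetSum _ fun n _ => (hLp n).integrable (by norm_num)]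
    exact Finset.sum_congr rfl fun n _ => hμ.integral_coord hq n (f n)
  have hvar : ∀ N, ProbabilityTheory.variance (∑ n ∈ Finset.range N, X n) μ ≤ N * C := by
    intro N
    rw [ProbabilityTheory.IndepFun.variance_sum (fun n _ => hLp n)]
    · calc ∑ n ∈ Finset.range N, ProbabilityTheory.variance (X n) μ
          ≤ ∑ n ∈ Finset.range N, C := by
            refine Finset.sum_le_sum fun n _ => ?_
            refine (ProbabilityTheory.variance_le_expectation_sq
              (hLp n).aestronglyMeasurable).trans ?_
            refine le_trans (le_of_eq ?_) (hC n)
            exact hμ.integral_coord hq n (fun a => f n a ^ 2)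
        _ = N * C := by simp
    · intro m _ n _ hmn
      exact (hμ.indepFun_coord hq hmn).comp (φ := f m) (ψ := f n) Measurable.of_discrete
        Measurable.of_discrete
  have hCnn : 0 ≤ C := le_trans
    (Finset.sum_nonneg fun a _ => mul_nonneg ((hq 0).1 a) (sq_nonneg _)) (hC 0)
  have hBC : ∀ j : ℕ, ∀ᵐ ω ∂μ, ∀ᶠ k : ℕ in atTop,
      |(∑ n ∈ Finset.range ((k + 1) ^ 2), X n) ω - e ((k + 1) ^ 2)|
        < (1 / ((j : ℝ) + 1)) * ((k : ℝ) + 1) ^ 2 := by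
    intro j
    set ε : ℝ := 1 / ((j : ℝ) + 1) with hε
    have hε0 : 0 < ε := by positivity
    set s : ℕ → Set (ℕ → Φ.Symb) := fun k => {ω | ε * ((k : ℝ) + 1) ^ 2 ≤
      |(∑ n ∈ Finset.range ((k + 1) ^ 2), X n) ω - e ((k + 1) ^ 2)|} with hs
    have hsm : ∀ k, μ (s k) ≤ ENNReal.ofReal (C / ε ^ 2 * (1 / ((k : ℝ) + 1) ^ 2)) := by
      intro k
      have hLp' : MemLp (∑ n ∈ Finset.range ((k + 1) ^ 2), X n) 2 μ :=
        memLp_finsetSum' _ fun n _ => hLp n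
      have h := ProbabilityTheory.meas_ge_le_variance_div_sq hLp'
        (c := ε * ((k : ℝ) + 1) ^ 2) (by positivity)
      rw [hmean] at h
      refine h.trans (ENNReal.ofReal_le_ofReal ?_)
      have h2 := hvar ((k + 1) ^ 2)
      push_cast at h2
      calc _ ≤ (((k : ℝ) + 1) ^ 2 * C) / (ε * ((k : ℝ) + 1) ^ 2) ^ 2 := by gcongr
        _ = _ := by field_simp
    have hsum : ∑' k, μ (s k) ≠ ⊤ := by
      have hsmm : Summable fun k : ℕ => C / ε ^ 2 * (1 / ((k : ℝ) + 1) ^ 2) := by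
        refine Summable.mul_left _ ?_
        have := (summable_nat_add_iff 1).2 (Real.summable_one_div_nat_pow.2 one_lt_two)
        simpa using this
      refine ne_top_of_le_ne_top ?_ (ENNReal.tsum_le_tsum hsm)
      exact hsmm.tsum_ofReal_ne_top
    filter_upwards [ae_eventually_notMem hsum] with ω hω
    filter_upwards [hω] with k hk
    simpa [hs] using hk
  filter_upwards [ae_all_iff.2 hBC] with ω hω
  refine tendsto_sub_div_of_tendsto_sq (s := fun N => ∑ n ∈ Finset.range N, f n (ω n))
    (e := e) (C := 1 + C) ?_ ?_ ?_ ?_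
  · refine monotone_nat_of_le_succ fun n => ?_
    simp only [Finset.sum_range_succ]
    linarith [f0 n (ω n)]
  · refine monotone_nat_of_le_succ fun n => ?_
    simp only [he, Finset.sum_range_succ]
    linarith [Finset.sum_nonneg fun a (_ : a ∈ Finset.univ) =>
      mul_nonneg ((hq n).1 a) (f0 n a)]
  · intro n
    simp only [he, Finset.sum_range_succ, add_sub_cancel_left]
    calc ∑ a, q n a * f n a ≤ ∑ a, (q n a + q n a * f n a ^ 2) := by
          refine Finset.sum_le_sum fun a _ => ?_
          nlinarith [(hq n).1 a, mul_nonneg ((hq n).1 a) (sq_nonneg (f n a - 1)),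
            mul_nonneg ((hq n).1 a) (sq_nonneg (f n a))]
      _ ≤ 1 + C := by
          rw [Finset.sum_add_distrib, (hq n).2]
          linarith [hC n]
  · rw [← tendsto_add_atTop_iff_nat 1]
    rw [Metric.tendsto_atTop]
    intro ε hε
    obtain ⟨j, hj⟩ := exists_nat_one_div_lt hε
    obtain ⟨K, hK⟩ := eventually_atTop.1 (hω j)
    refine ⟨K, fun k hk => ?_⟩
    have h := hK k hk
    rw [Real.dist_eq, sub_zero, abs_div]
    push_cast
    rw [abs_of_pos (show (0 : ℝ) < ((k : ℝ) + 1) ^ 2 by positivity), div_lt_iff₀ (by positivity)]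
    simp only [Finset.sum_apply, hX] at h
    refine h.trans_le ?_
    gcongr

end IsProductMeasure

/-- A function continuous on `(0,∞)` and invariant under multiplication of its argument by
`lam`. -/
structure MulPeriodic (lam : ℝ) (G : ℝ → ℝ) : Prop where
  cont : ContinuousOn G (Set.Ioi 0)
  periodic : ∀ b > 0, G (lam * b) = G b

namespace MulPeriodic

variable {lam : ℝ} {G : ℝ → ℝ}

theorem continuous_comp_exp (h : MulPeriodic lam G) : Continuous fun t => G (Real.exp t) :=
  h.cont.comp_continuous Real.continuous_exp fun t => Real.exp_pos t

theorem periodic_comp_exp (h : MulPeriodic lam G) (hl : 1 < lam) :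
    Function.Periodic (fun t => G (Real.exp t)) (Real.log lam) := by
  intro t
  simp only [Real.exp_add, Real.exp_log (zero_lt_one.trans hl)]
  rw [mul_comm, h.periodic _ (Real.exp_pos t)]

theorem exists_bound (h : MulPeriodic lam G) (hl : 1 < lam) :
    ∃ C, 0 ≤ C ∧ ∀ b > 0, |G b| ≤ C := by
  obtain ⟨C, hC⟩ := ((h.periodic_comp_exp hl).isBounded_of_continuous
    (Real.log_pos hl).ne' h.continuous_comp_exp).exists_norm_le
  have hb : ∀ b > 0, |G b| ≤ C := by
    intro b hb
    have := hC (G b) ⟨Real.log b, by simp [Real.exp_log hb]⟩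
    simpa using this
  exact ⟨C, (abs_nonneg _).trans (hb 1 one_pos), hb⟩

theorem uniformContinuous_comp_exp (h : MulPeriodic lam G) (hl : 1 < lam) :
    UniformContinuous fun t => G (Real.exp t) := by
  set T := Real.log lam
  have hT : 0 < T := Real.log_pos hl
  have hper := h.periodic_comp_exp hl
  have hK : UniformContinuousOn (fun t => G (Real.exp t)) (Icc (-T) (2 * T)) :=
    isCompact_Icc.uniformContinuousOn_of_continuous h.continuous_comp_exp.continuousOn
  rw [Metric.uniformContinuousOn_iff] at hK
  rw [Metric.uniformContinuous_iff]
  intro ε hε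
  obtain ⟨δ, hδ, H⟩ := hK ε hε
  refine ⟨min δ T, lt_min hδ hT, fun x y hxy => ?_⟩
  have hx0 := Int.floor_le (x / T)
  have hx1 := Int.lt_floor_add_one (x / T)
  rw [le_div_iff₀ hT] at hx0
  rw [div_lt_iff₀ hT] at hx1
  have hd := hxy
  rw [Real.dist_eq, lt_min_iff, abs_lt, abs_lt] at hd
  obtain ⟨⟨_, _⟩, h3, h4⟩ := hd
  have := H (x - ⌊x / T⌋ * T) ⟨by linarith, by linarith⟩ (y - ⌊x / T⌋ * T)
    ⟨by linarith, by linarith⟩ (by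
      rw [Real.dist_eq, sub_sub_sub_cancel_right, ← Real.dist_eq]
      exact hxy.trans_le (min_le_left _ _))
  have e1 := hper.sub_int_mul_eq (x := x) ⌊x / T⌋
  have e2 := hper.sub_int_mul_eq (x := y) ⌊x / T⌋
  rwa [e1, e2] at this

theorem integrableOn (h : MulPeriodic lam G) (hl : 1 < lam) (x : ℝ) :
    IntegrableOn G (Ioc 0 x) := by
  obtain ⟨C, _, hC⟩ := h.exists_bound hl
  refine Integrable.of_bound
    ((h.cont.mono Ioc_subset_Ioi_self).aestronglyMeasurable measurableSet_Ioc) C ?_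
  exact (ae_restrict_mem measurableSet_Ioc).mono fun b hb => hC b hb.1

theorem intervalIntegrable (h : MulPeriodic lam G) (hl : 1 < lam) {x y : ℝ} (hx : 0 ≤ x)
    (hy : 0 ≤ y) : IntervalIntegrable G volume x y := by
  rw [intervalIntegrable_iff]
  refine (h.integrableOn hl (max x y)).mono_set ?_
  exact Ioc_subset_Ioc_left (le_min hx hy)

theorem integral_sub (h : MulPeriodic lam G) (hl : 1 < lam) {x y : ℝ} (hx : 0 ≤ x)
    (hy : 0 ≤ y) :
    (∫ b in (0 : ℝ)..y, G b) - ∫ b in (0 : ℝ)..x, G b = ∫ b in x..y, G b :=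
  intervalIntegral.integral_interval_sub_left (h.intervalIntegrable hl le_rfl hy)
    (h.intervalIntegrable hl le_rfl hx)

theorem abs_integral_le {C : ℝ} (hC : ∀ b > 0, |G b| ≤ C) {x y : ℝ} (hx : 0 ≤ x)
    (hy : 0 ≤ y) : |∫ b in x..y, G b| ≤ C * |y - x| := by
  have := intervalIntegral.norm_integral_le_of_norm_le_const (f := G) (C := C) (a := x) (b := y)
    (fun b hb => hC b (lt_of_le_of_lt (le_min hx hy) hb.1))
  simpa using this

theorem mul_le_integral (h : MulPeriodic lam G) (hl : 1 < lam) {m : ℝ}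
    (hm : ∀ b > 0, m ≤ G b) {x y : ℝ} (hx : 0 ≤ x) (hxy : x ≤ y) :
    m * (y - x) ≤ ∫ b in x..y, G b := by
  have := intervalIntegral.integral_mono_on_of_le_Ioo hxy (f := fun _ => m) (g := G)
    intervalIntegrable_const (h.intervalIntegrable hl hx (hx.trans hxy))
    (fun b hb => hm b (hx.trans_lt hb.1))
  simpa [mul_comm] using this

theorem integral_mul_left {t : ℝ} (ht : 0 < t) (hper : ∀ b > 0, G (t * b) = G b)
    {x : ℝ} (hx : 0 ≤ x) :
    ∫ b in (0 : ℝ)..(t * x), G b = t * ∫ b in (0 : ℝ)..x, G b := by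
  have h1 := intervalIntegral.integral_comp_mul_left (a := 0) (b := x) G ht.ne'
  rw [mul_zero, smul_eq_mul] at h1
  have h2 : ∫ b in (0 : ℝ)..x, G (t * b) = ∫ b in (0 : ℝ)..x, G b := by
    rw [intervalIntegral.integral_of_le hx, intervalIntegral.integral_of_le hx]
    exact setIntegral_congr_fun measurableSet_Ioc fun b hb => hper b hb.1
  rw [← h2, h1]
  field_simp

theorem tendsto_sub_integral (h : MulPeriodic lam G) (hl : 1 < lam) :
    Tendsto (fun n : ℕ => G (n + 1) - ∫ b in (n : ℝ)..(n + 1), G b) atTop (𝓝 0) := by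
  have hu := h.uniformContinuous_comp_exp hl
  rw [Metric.uniformContinuous_iff] at hu
  rw [Metric.tendsto_atTop]
  intro ε hε
  obtain ⟨δ, hδ, H⟩ := hu (ε / 2) (by positivity)
  obtain ⟨n₀, hn₀⟩ := exists_nat_one_div_lt hδ
  refine ⟨n₀ + 1, fun n hn => ?_⟩
  have hn' : ((n₀ : ℝ) + 1) ≤ n := by exact_mod_cast hn
  have hnpos : (0 : ℝ) < n := lt_of_lt_of_le (by positivity) hn'
  have hb : ∀ b ∈ Set.uIoc (n : ℝ) (n + 1), ‖G (n + 1) - G b‖ ≤ ε / 2 := by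
    intro b hb
    rw [uIoc_of_le (by linarith)] at hb
    have hb0 : 0 < b := hnpos.trans hb.1
    have := H (a := Real.log (n + 1)) (b := Real.log b) (by
      rw [Real.dist_eq, ← Real.log_div (by positivity) hb0.ne', abs_of_nonneg
        (Real.log_nonneg (by rw [le_div_iff₀ hb0]; linarith [hb.2]))]
      have h1 := Real.log_le_sub_one_of_pos (x := ((n : ℝ) + 1) / b) (by positivity)
      have h2 : ((n : ℝ) + 1) / b ≤ (n + 1) / n := by
        gcongr; exact hb.1.le
      have h3 : ((n : ℝ) + 1) / n - 1 = 1 / n := by field_simp; ring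
      have h4 : 1 / (n : ℝ) ≤ 1 / (n₀ + 1) := by gcongr
      linarith)
    rw [Real.exp_log hb0, Real.exp_log (by positivity), Real.dist_eq] at this
    exact this.le
  have := intervalIntegral.norm_integral_le_of_norm_le_const hb
  rw [intervalIntegral.integral_sub intervalIntegrable_const
    (h.intervalIntegrable hl hnpos.le (by positivity))] at this
  simp only [intervalIntegral.integral_const, add_sub_cancel_left, one_smul, abs_one,
    mul_one] at this
  rw [dist_zero_right]
  linarith

/-- Sampling at the positive integers computes the integral up to a sublinear error. -/
theorem tendsto_sum_sub_integral_div (h : MulPeriodic lam G) (hl : 1 < lam) :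
    Tendsto (fun N : ℕ => (∑ n ∈ Finset.range N, G (n + 1)
      - ∫ b in (0 : ℝ)..N, G b) / N) atTop (𝓝 0) := by
  refine (h.tendsto_sub_integral hl).cesaro.congr fun N => ?_
  have := intervalIntegral.sum_integral_adjacent_intervals (f := G) (μ := volume)
    (a := fun k : ℕ => (k : ℝ)) (n := N)
    (fun k _ => h.intervalIntegrable hl (by positivity) (by positivity))
  simp only [Nat.cast_add, Nat.cast_one, Nat.cast_zero] at this
  rw [Finset.sum_sub_distrib, this, div_eq_inv_mul]

theorem exists_pow_scale (hl : 1 < lam) {x : ℝ} (hx : 1 ≤ x) :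
    ∃ (k : ℕ) (y : ℝ), y ∈ Icc 1 lam ∧ x = lam ^ k * y := by
  obtain ⟨k, hk1, hk2⟩ := exists_nat_pow_near hx hl
  have hp : 0 < lam ^ k := by positivity
  refine ⟨k, x / lam ^ k, ⟨?_, ?_⟩, ?_⟩
  · rwa [one_le_div hp]
  · rw [div_le_iff₀ hp, ← pow_succ']; exact hk2.le
  · field_simp

/-- A nonnegative multiplicatively periodic function that is positive on a dense set has
integral growing linearly over the windows `[x, (1 + ε) x]`. -/
theorem exists_mul_le_integral_window (h : MulPeriodic lam G) (hl : 1 < lam)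
    (h0 : ∀ b > 0, 0 ≤ G b) (hdense : Ioi (0 : ℝ) ⊆ closure {b | 0 < b ∧ 0 < G b})
    {ε : ℝ} (hε : 0 < ε) :
    ∃ c > 0, ∀ x, 1 ≤ x → c * x ≤ ∫ b in x..((1 + ε) * x), G b := by
  have hl0 : 0 < lam := zero_lt_one.trans hl
  obtain ⟨C, hC0, hC⟩ := h.exists_bound hl
  set P : ℝ → ℝ := fun x => ∫ b in (0 : ℝ)..x, G b with hP
  have hsub : ∀ x, 1 ≤ x → P ((1 + ε) * x) - P x = ∫ b in x..((1 + ε) * x), G b := by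
    intro x hx
    exact h.integral_sub hl (by positivity) (by positivity)
  have hcont : ContinuousOn P (Ici 0) := by
    refine (LipschitzOnWith.of_dist_le_mul (K := ⟨C, hC0⟩) fun x hx y hy => ?_).continuousOn
    rw [Real.dist_eq, Real.dist_eq, h.integral_sub hl hy hx]
    exact abs_integral_le hC hy hx
  set φ : ℝ → ℝ := fun x => P ((1 + ε) * x) - P x with hφ
  have hφc : ContinuousOn φ (Icc 1 lam) := by
    refine ContinuousOn.sub ?_ (hcont.mono fun x hx => ?_)
    · refine hcont.comp (continuous_const.mul continuous_id).continuousOn fun x hx => ?_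
      have : (0 : ℝ) ≤ x := zero_le_one.trans hx.1
      simp only [mem_Ici]; positivity
    · exact zero_le_one.trans hx.1
  have hpos : ∀ x, 1 ≤ x → 0 < φ x := by
    intro x hx
    have hx0 : 0 < x := zero_lt_one.trans_le hx
    have hlt : x < (1 + ε) * x := by nlinarith
    simp only [hφ]
    rw [hsub x hx]
    obtain ⟨b, hb, hbG⟩ : ∃ b ∈ Ioo x ((1 + ε) * x), 0 < G b := by
      obtain ⟨y, hy⟩ := nonempty_Ioo.2 hlt
      obtain ⟨b, hb1, hb2⟩ := mem_closure_iff.1 (hdense (hx0.trans hy.1)) _ isOpen_Ioo hy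
      exact ⟨b, hb1, hb2.2⟩
    refine intervalIntegral.integral_pos hlt (h.cont.mono fun b hb => hx0.trans_le hb.1)
      (fun b hb => h0 b (hx0.trans hb.1)) ⟨b, Ioo_subset_Icc_self hb, hbG⟩
  obtain ⟨z, hz, hmin⟩ := isCompact_Icc.exists_isMinOn (nonempty_Icc.2 hl.le) hφc
  refine ⟨φ z / lam, div_pos (hpos z hz.1) hl0, fun x hx => ?_⟩
  obtain ⟨k, y, hy, rfl⟩ := exists_pow_scale hl hx
  have hperk : ∀ k : ℕ, ∀ b > 0, G (lam ^ k * b) = G b := by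
    intro k
    induction k with
    | zero => simp
    | succ k ih =>
      intro b hb
      rw [pow_succ', mul_assoc, h.periodic _ (by positivity), ih b hb]
  have hy0 : 0 < y := zero_lt_one.trans_le hy.1
  have hpk : 0 < lam ^ k := by positivity
  rw [← hsub _ hx, mul_left_comm (1 + ε)]
  simp only [hP]
  rw [integral_mul_left hpk (hperk k) (by positivity), integral_mul_left hpk (hperk k) hy0.le]
  have h1 : φ z ≤ φ y := hmin hy
  have h2 : φ z / lam * y ≤ φ z := by
    rw [div_mul_eq_mul_div, div_le_iff₀ hl0]
    exact mul_le_mul_of_nonneg_left hy.2 (hpos z hz.1).le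
  calc φ z / lam * (lam ^ k * y) = lam ^ k * (φ z / lam * y) := by ring
    _ ≤ lam ^ k * φ y := by gcongr; exact h2.trans h1
    _ = _ := by simp only [hφ, hP]; ring

end MulPeriodic

/-- Uniform form of `e N = o(N)` along initial segments. -/
theorem eventually_forall_abs_le_of_tendsto_div {e : ℕ → ℝ} (he0 : e 0 = 0)
    (h : Tendsto (fun N : ℕ => e N / N) atTop (𝓝 0)) {ε : ℝ} (hε : 0 < ε) :
    ∀ᶠ K : ℕ in atTop, ∀ N ≤ K, |e N| ≤ ε * K := by
  obtain ⟨N₀, hN₀⟩ := Metric.tendsto_atTop.1 h ε hε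
  obtain ⟨K₀, hK₀⟩ := exists_nat_ge ((∑ n ∈ Finset.range N₀, |e n|) / ε)
  filter_upwards [eventually_ge_atTop K₀] with K hK N hNK
  rcases lt_or_ge N N₀ with hN | hN
  · have h1 : |e N| ≤ ∑ n ∈ Finset.range N₀, |e n| :=
      Finset.single_le_sum (f := fun n => |e n|) (fun n _ => abs_nonneg _)
        (Finset.mem_range.2 hN)
    rw [div_le_iff₀ hε] at hK₀
    have : (K₀ : ℝ) ≤ K := by exact_mod_cast hK
    nlinarith
  · rcases Nat.eq_zero_or_pos N with rfl | hpos
    · rw [he0, abs_zero]; positivity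
    · have h1 := hN₀ N hN
      have hN' : (0 : ℝ) < N := by exact_mod_cast hpos
      rw [Real.dist_eq, sub_zero, abs_div, Nat.abs_cast, div_lt_iff₀ hN'] at h1
      have : (N : ℝ) ≤ K := by exact_mod_cast hNK
      nlinarith

theorem exists_pos_forall_le {κ : Type*} [Finite κ] (f : κ → ℝ) (hf : ∀ k, 0 < f k) :
    ∃ m > 0, ∀ k, m ≤ f k := by
  cases isEmpty_or_nonempty κ
  · exact ⟨1, one_pos, fun k => isEmptyElim k⟩
  · obtain ⟨k₀, hk₀⟩ := Finite.exists_min f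
    exact ⟨f k₀, hf k₀, hk₀⟩

theorem Real.mul_log_sq_le {x : ℝ} (h0 : 0 < x) (h1 : x ≤ 1) : x * Real.log x ^ 2 ≤ 4 := by
  have h := Real.abs_log_mul_self_rpow_lt x (1 / 2) h0 h1 (by norm_num)
  rw [← Real.sqrt_eq_rpow] at h
  have h2 := abs_lt.1 h
  have h3 : (Real.log x * √x) ^ 2 ≤ 4 := by nlinarith
  rw [mul_pow, Real.sq_sqrt h0.le] at h3
  linarith

namespace DiagIFS

variable (Φ : DiagIFS d A)

theorem le_cylMass {p : Φ.Symb → ℝ} (hp : IsProbVec p) (I : Finset (Fin d)) (a : Φ.Symb) :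
    p a ≤ Φ.cylMass I p a := by
  have := Finset.single_le_sum (f := fun b : Φ.Symb => if ∀ i ∈ I, b.1 i = a.1 i then p b else 0)
    (fun b _ => by split_ifs; exacts [hp.1 b, le_rfl]) (Finset.mem_univ a)
  simpa [cylMass] using this

theorem cylMass_nonneg {p : Φ.Symb → ℝ} (hp : IsProbVec p) (I : Finset (Fin d)) (a : Φ.Symb) :
    0 ≤ Φ.cylMass I p a :=
  (hp.1 a).trans (Φ.le_cylMass hp I a)

theorem cylMass_le_one {p : Φ.Symb → ℝ} (hp : IsProbVec p) (I : Finset (Fin d)) (a : Φ.Symb) :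
    Φ.cylMass I p a ≤ 1 := by
  rw [← hp.2, cylMass]
  refine Finset.sum_le_sum fun b _ => ?_
  split_ifs
  exacts [le_rfl, hp.1 b]

theorem cylMass_empty {p : Φ.Symb → ℝ} (hp : IsProbVec p) (a : Φ.Symb) :
    Φ.cylMass ∅ p a = 1 := by
  rw [← hp.2, cylMass]; simp

theorem neg_log_cylMass_nonneg {p : Φ.Symb → ℝ} (hp : IsProbVec p) (I : Finset (Fin d))
    (a : Φ.Symb) : 0 ≤ -Real.log (Φ.cylMass I p a) :=
  neg_nonneg.2 (Real.log_nonpos (Φ.cylMass_nonneg hp I a) (Φ.cylMass_le_one hp I a))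

theorem sum_mul_neg_log_cylMass_sq_le {p : Φ.Symb → ℝ} (hp : IsProbVec p)
    (I : Finset (Fin d)) :
    ∑ a, p a * (-Real.log (Φ.cylMass I p a)) ^ 2 ≤ 4 * Fintype.card Φ.Symb := by
  calc _ ≤ ∑ a : Φ.Symb, (4 : ℝ) := by
        refine Finset.sum_le_sum fun a _ => ?_
        rw [neg_sq]
        rcases (hp.1 a).eq_or_lt with h | h
        · rw [← h]; norm_num
        · refine le_trans ?_ (Real.mul_log_sq_le (h.trans_le (Φ.le_cylMass hp I a))
            (Φ.cylMass_le_one hp I a))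
          gcongr
          exact Φ.le_cylMass hp I a
    _ = _ := by rw [Finset.sum_const, nsmul_eq_mul, mul_comm]; rfl

theorem entropy_empty {p : Φ.Symb → ℝ} (hp : IsProbVec p) : Φ.entropy ∅ p = 0 := by
  simp [entropy, Φ.cylMass_empty hp]

theorem entropy_eq_sum (I : Finset (Fin d)) (p : Φ.Symb → ℝ) :
    Φ.entropy I p = ∑ a, p a * -Real.log (Φ.cylMass I p a) := by
  simp [entropy]

theorem entropy_nonneg {p : Φ.Symb → ℝ} (hp : IsProbVec p) (I : Finset (Fin d)) :
    0 ≤ Φ.entropy I p := by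
  rw [entropy_eq_sum]
  exact Finset.sum_nonneg fun a _ => mul_nonneg (hp.1 a) (Φ.neg_log_cylMass_nonneg hp I a)

theorem continuous_entropy (I : Finset (Fin d)) : Continuous (Φ.entropy I) := by
  let ρ : Φ.Symb → ∀ i : I, A i := fun a i => a.1 i
  have hcyl : ∀ p a, Φ.cylMass I p a = ∑ b : Φ.Symb with ρ b = ρ a, p b := by
    intro p a
    rw [cylMass, Finset.sum_filter]
    refine Finset.sum_congr rfl fun b _ => ?_
    have : (∀ i ∈ I, b.1 i = a.1 i) ↔ ρ b = ρ a := by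
      simp [ρ, funext_iff]
    simp only [this]
  have heq : Φ.entropy I = fun p => ∑ u, Real.negMulLog (∑ b : Φ.Symb with ρ b = u, p b) := by
    funext p
    rw [entropy, ← Finset.sum_fiberwise Finset.univ ρ, ← Finset.sum_neg_distrib]
    refine Finset.sum_congr rfl fun u _ => ?_
    rw [Real.negMulLog, neg_mul, neg_inj, Finset.sum_mul]
    refine Finset.sum_congr rfl fun a ha => ?_
    rw [hcyl, (Finset.mem_filter.1 ha).2]
  rw [heq]
  fun_prop

theorem continuous_chi (i : Fin d) : Continuous (Φ.chi i) := by
  unfold chi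
  fun_prop

variable {Φ}

theorem Valid.exists_rate_bounds (hV : Φ.Valid) :
    ∃ m M : ℝ, 0 < m ∧ 0 < M ∧ ∀ i a, m ≤ -Real.log |Φ.slope i a| ∧
      -Real.log |Φ.slope i a| ≤ M := by
  have hpos : ∀ x : (Σ i, A i), 0 < -Real.log |Φ.slope x.1 x.2| := fun x =>
    neg_pos.2 (Real.log_neg (abs_pos.2 (hV.2.1 x.1 x.2)) (hV.2.2.1 x.1 x.2))
  obtain ⟨m, hm0, hm⟩ := exists_pos_forall_le _ hpos
  obtain ⟨M, hM0, hM⟩ := exists_pos_forall_le _ fun x => inv_pos.2 (hpos x)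
  exact ⟨m, M⁻¹, hm0, inv_pos.2 hM0, fun i a => ⟨hm ⟨i, a⟩,
    (le_inv_comm₀ hM0 (hpos ⟨i, a⟩)).1 (hM ⟨i, a⟩)⟩⟩

theorem chi_mem_Icc {m M : ℝ} (hmM : ∀ i a, m ≤ -Real.log |Φ.slope i a| ∧
    -Real.log |Φ.slope i a| ≤ M) (i : Fin d) {p : Φ.Symb → ℝ} (hp : IsProbVec p) :
    m ≤ Φ.chi i p ∧ Φ.chi i p ≤ M := by
  have hchi : Φ.chi i p = ∑ a, p a * -Real.log |Φ.slope i (a.1 i)| := by simp [chi]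
  rw [hchi]
  constructor
  · calc m = ∑ a, p a * m := by rw [← Finset.sum_mul, hp.2, one_mul]
      _ ≤ _ := Finset.sum_le_sum fun a _ =>
        mul_le_mul_of_nonneg_left (hmM i (a.1 i)).1 (hp.1 a)
  · calc _ ≤ ∑ a, p a * M := Finset.sum_le_sum fun a _ =>
        mul_le_mul_of_nonneg_left (hmM i (a.1 i)).2 (hp.1 a)
      _ = M := by rw [← Finset.sum_mul, hp.2, one_mul]

/-- The entropy integral `∫_0^∞ h({i : b ≤ t_i}; r_b) db` as a function of the thresholds. -/
noncomputable def entropyIntegral (Φ : DiagIFS d A) (r : ℝ → Φ.Symb → ℝ) (t : Fin d → ℝ) : ℝ :=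
  ∫ b in Set.Ioi (0 : ℝ), Φ.entropy (Finset.univ.filter fun i => b ≤ t i) (r b)

end DiagIFS

theorem deltaRB_eq (Φ : DiagIFS d A) (r : ℝ → Φ.Symb → ℝ) (B : ℝ) :
    deltaRB Φ r B = B⁻¹ * Φ.entropyIntegral r (Bcoord Φ r B) := rfl

namespace Cycle

variable {Φ : DiagIFS d A} (c : Cycle Φ)

theorem mulPeriodic_comp {h : (Φ.Symb → ℝ) → ℝ} (hh : Continuous h) :
    MulPeriodic c.lam fun b => h (c.r b) :=
  ⟨hh.comp_continuousOn c.cont, fun b hb => by rw [c.periodic b hb]⟩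

theorem Bcoord_eq (hl : 1 < c.lam) (hV : Φ.Valid) {B x : ℝ} {i : Fin d} (hx : 0 ≤ x)
    (h : ∫ b in (0 : ℝ)..x, Φ.chi i (c.r b) = B) : Bcoord Φ c.r B i = x := by
  obtain ⟨m, M, hm, hM, hmM⟩ := hV.exists_rate_bounds
  have hG := c.mulPeriodic_comp (Φ.continuous_chi i)
  have hset : {y : ℝ | 0 ≤ y ∧ B ≤ ∫ b in Set.Ioc (0 : ℝ) y, Φ.chi i (c.r b)} = Ici x := by
    ext y
    simp only [mem_ofPred_eq, mem_Ici]
    constructor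
    · rintro ⟨hy, hBy⟩
      rw [← intervalIntegral.integral_of_le hy, ← h] at hBy
      by_contra! hlt
      have h1 := hG.mul_le_integral hl (m := m)
        (fun b hb => (Φ.chi_mem_Icc hmM i (c.prob b hb)).1) hy hlt.le
      rw [← hG.integral_sub hl hy hx] at h1
      have := mul_pos hm (sub_pos.2 hlt)
      linarith
    · intro hxy
      have hy := hx.trans hxy
      refine ⟨hy, ?_⟩
      rw [← intervalIntegral.integral_of_le hy, ← h]
      have h1 := hG.mul_le_integral hl (m := m)
        (fun b hb => (Φ.chi_mem_Icc hmM i (c.prob b hb)).1) hx hxy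
      rw [← hG.integral_sub hl hx hy] at h1
      have := mul_nonneg hm.le (sub_nonneg.2 hxy)
      linarith
  rw [Bcoord, hset, csInf_Ici]

theorem Bcoord_spec (hl : 1 < c.lam) (hV : Φ.Valid) {B : ℝ} (hB : 0 ≤ B) (i : Fin d) :
    0 ≤ Bcoord Φ c.r B i ∧ ∫ b in (0 : ℝ)..(Bcoord Φ c.r B i), Φ.chi i (c.r b) = B := by
  obtain ⟨m, M, hm, hM, hmM⟩ := hV.exists_rate_bounds
  have hG := c.mulPeriodic_comp (Φ.continuous_chi i)
  obtain ⟨C, hC0, hC⟩ := hG.exists_bound hl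
  have hcont : ContinuousOn (fun x => ∫ b in (0 : ℝ)..x, Φ.chi i (c.r b)) (Icc 0 (B / m)) := by
    refine (LipschitzOnWith.of_dist_le_mul (K := ⟨C, hC0⟩) fun x hx y hy => ?_).continuousOn
    rw [Real.dist_eq, Real.dist_eq, hG.integral_sub hl hy.1 hx.1]
    exact MulPeriodic.abs_integral_le hC hy.1 hx.1
  have h0 : 0 ≤ B / m := by positivity
  have h1 := hG.mul_le_integral hl (m := m)
    (fun b hb => (Φ.chi_mem_Icc hmM i (c.prob b hb)).1) le_rfl h0
  rw [sub_zero, mul_div_cancel₀ _ hm.ne'] at h1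
  obtain ⟨x, hx, hxB⟩ := intermediate_value_Icc h0 hcont ⟨by simpa using hB, h1⟩
  rw [c.Bcoord_eq hl hV hx.1 hxB]
  exact ⟨hx.1, hxB⟩

/-- For a cycle with period `1`, the same curve viewed as a cycle with period `2`. -/
theorem exists_one_lt_lam : ∃ c' : Cycle Φ, 1 < c'.lam ∧ c'.r = c.r := by
  rcases c.one_le_lam.eq_or_lt with h | h
  · refine ⟨⟨2, one_le_two, c.r, c.prob, c.cont, fun b hb => ?_, fun h2 => ?_⟩, one_lt_two, rfl⟩
    · exact c.const_of_lam_eq_one h.symm _ (by positivity) _ hb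
    · norm_num at h2
  · exact ⟨c, h, rfl⟩

theorem deltaRB_mul (hV : Φ.Valid) {t : ℝ} (ht : 0 < t) (hper : ∀ b > 0, c.r (t * b) = c.r b)
    {B : ℝ} (hB : 0 < B) : deltaRB Φ c.r (t * B) = deltaRB Φ c.r B := by
  obtain ⟨c', hl, hr⟩ := c.exists_one_lt_lam
  rw [← hr] at hper ⊢
  have hcoord : ∀ i, Bcoord Φ c'.r (t * B) i = t * Bcoord Φ c'.r B i := by
    intro i
    obtain ⟨h1, h2⟩ := c'.Bcoord_spec hl hV hB.le i
    refine c'.Bcoord_eq hl hV (by positivity) ?_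
    rw [MulPeriodic.integral_mul_left (G := fun b => Φ.chi i (c'.r b)) ht
      (fun b hb => by rw [hper b hb]) h1, h2]
  rw [deltaRB, deltaRB]
  have h := integral_comp_mul_left_Ioi (fun b => Φ.entropy
    (Finset.univ.filter fun i => b ≤ Bcoord Φ c'.r (t * B) i) (c'.r b)) 0 ht
  rw [mul_zero, smul_eq_mul] at h
  have h2 : ∫ b in Ioi (0 : ℝ), Φ.entropy
      (Finset.univ.filter fun i => t * b ≤ Bcoord Φ c'.r (t * B) i) (c'.r (t * b))
      = ∫ b in Ioi (0 : ℝ), Φ.entropy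
      (Finset.univ.filter fun i => b ≤ Bcoord Φ c'.r B i) (c'.r b) := by
    refine setIntegral_congr_fun measurableSet_Ioi fun b hb => ?_
    simp only [hcoord, mul_le_mul_iff_right₀ ht, hper b hb]
  rw [← h2, h]
  field_simp

theorem deltaRB_lam_pow_mul (hV : Φ.Valid) (k : ℕ) {B : ℝ} (hB : 0 < B) :
    deltaRB Φ c.r (c.lam ^ k * B) = deltaRB Φ c.r B := by
  have hl0 : 0 < c.lam := zero_lt_one.trans_le c.one_le_lam
  induction k with
  | zero => simp
  | succ k ih =>
    rw [pow_succ', mul_assoc, c.deltaRB_mul hV hl0 c.periodic (by positivity), ih]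

theorem deltaRB_image (hV : Φ.Valid) :
    deltaRB Φ c.r '' Icc 1 c.lam = deltaRB Φ c.r '' Ioi 0 := by
  have hl0 : 0 < c.lam := zero_lt_one.trans_le c.one_le_lam
  refine Subset.antisymm (image_mono fun x hx => zero_lt_one.trans_le hx.1) ?_
  rintro _ ⟨B, hB, rfl⟩
  have hB' : 0 < B := hB
  rcases c.one_le_lam.eq_or_lt with h | h
  · refine ⟨1, ⟨le_rfl, c.one_le_lam⟩, ?_⟩
    have := c.deltaRB_mul hV hB' (fun b hb =>
      c.const_of_lam_eq_one h.symm _ (by positivity) _ hb) one_pos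
    rw [← this, mul_one]
  · obtain ⟨n, hn⟩ := pow_unbounded_of_one_lt B⁻¹ h
    have h1 : 1 ≤ c.lam ^ n * B := by
      rw [inv_lt_iff_one_lt_mul₀ hB'] at hn
      exact hn.le
    obtain ⟨k, y, hy, hky⟩ := MulPeriodic.exists_pow_scale h h1
    refine ⟨y, hy, ?_⟩
    rw [← c.deltaRB_lam_pow_mul hV n hB', hky,
      c.deltaRB_lam_pow_mul hV k (zero_lt_one.trans_le hy.1)]

theorem delta_eq (hV : Φ.Valid) : c.delta = sInf (deltaRB Φ c.r '' Ioi 0) := by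
  rw [delta, c.deltaRB_image hV]

theorem entropyIntegral_nonneg (t : Fin d → ℝ) : 0 ≤ Φ.entropyIntegral c.r t :=
  setIntegral_nonneg measurableSet_Ioi fun b hb => Φ.entropy_nonneg (c.prob b hb) _

theorem deltaRB_nonneg {B : ℝ} (hB : 0 < B) : 0 ≤ deltaRB Φ c.r B :=
  mul_nonneg (inv_nonneg.2 hB.le) (c.entropyIntegral_nonneg _)

theorem delta_le (hV : Φ.Valid) {B : ℝ} (hB : 0 < B) : c.delta ≤ deltaRB Φ c.r B := by
  rw [c.delta_eq hV]
  refine csInf_le ⟨0, ?_⟩ ⟨B, hB, rfl⟩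
  rintro _ ⟨B', hB', rfl⟩
  exact c.deltaRB_nonneg hB'

theorem delta_nonneg (hV : Φ.Valid) : 0 ≤ c.delta := by
  rw [c.delta_eq hV]
  refine le_csInf ⟨_, 1, mem_Ioi.2 one_pos, rfl⟩ ?_
  rintro _ ⟨B', hB', rfl⟩
  exact c.deltaRB_nonneg hB'

end Cycle

theorem exists_lt_iff_of_antitone {P : ℕ → Prop} (hP : ∀ ⦃m n⦄, m ≤ n → P n → P m) (M : ℕ) :
    ∃ v ≤ M, ∀ n, n < v ↔ n < M ∧ P n := by
  induction M with
  | zero => exact ⟨0, le_rfl, by simp⟩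
  | succ M ih =>
    obtain ⟨v, hv, h⟩ := ih
    by_cases hM : P M
    · refine ⟨M + 1, le_rfl, fun n => ⟨fun hn => ⟨hn, hP (Nat.lt_succ_iff.1 hn) hM⟩, And.left⟩⟩
    · refine ⟨v, hv.trans M.le_succ, fun n => (h n).trans ?_⟩
      refine and_congr_left fun hn => ⟨fun h => h.trans M.lt_succ_self, fun h => ?_⟩
      exact lt_of_le_of_ne (Nat.lt_succ_iff.1 h) fun he => hM (he ▸ hn)

/-- If all initial sums of finitely many sequences are small, so is the sum obtained by switching
between the sequences along an antitone path of index sets. -/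
theorem abs_sum_antitone_le {z : Finset (Fin d) → ℕ → ℝ} {I : ℕ → Finset (Fin d)}
    (hI : Antitone I) {M : ℕ} {η : ℝ} (hz : ∀ J, ∀ N ≤ M, |∑ n ∈ Finset.range N, z J n| ≤ η) :
    |∑ n ∈ Finset.range M, z (I n) n| ≤ 2 ^ d * (2 * η) := by
  rw [← Finset.sum_fiberwise (Finset.range M) I]
  refine (Finset.abs_sum_le_sum_abs _ _).trans ?_
  have hcard : ∑ _J : Finset (Fin d), 2 * η = 2 ^ d * (2 * η) := by
    rw [Finset.sum_const, nsmul_eq_mul]; simp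
  rw [← hcard]
  refine Finset.sum_le_sum fun J _ => ?_
  obtain ⟨v, hv, hv'⟩ := exists_lt_iff_of_antitone (P := fun n => J ≤ I n)
    (fun m n hmn h => h.trans (hI hmn)) M
  obtain ⟨u, hu, hu'⟩ := exists_lt_iff_of_antitone (P := fun n => J ≤ I n ∧ I n ≠ J)
    (fun m n hmn h => ⟨h.1.trans (hI hmn), fun he => h.2 (le_antisymm (he ▸ hI hmn) h.1)⟩) M
  have hsub : Finset.range u ⊆ Finset.range v := by
    intro n hn
    have := (hu' n).1 (Finset.mem_range.1 hn)
    exact Finset.mem_range.2 ((hv' n).2 ⟨this.1, this.2.1⟩)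
  have hfib : (Finset.range M).filter (fun n => I n = J) = Finset.range v \ Finset.range u := by
    ext n
    simp only [Finset.mem_filter, Finset.mem_sdiff, Finset.mem_range, hv', hu', not_and, not_not]
    constructor
    · rintro ⟨h1, rfl⟩
      exact ⟨⟨h1, le_rfl⟩, fun _ _ => rfl⟩
    · rintro ⟨⟨h1, h2⟩, h3⟩
      exact ⟨h1, h3 h1 h2⟩
  have h1 : ∑ n ∈ Finset.range M with I n = J, z (I n) n
      = ∑ n ∈ Finset.range M with I n = J, z J n :=
    Finset.sum_congr rfl fun n hn => by rw [(Finset.mem_filter.1 hn).2]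
  have h2 := Finset.sum_sdiff hsub (f := z J)
  rw [h1, hfib, eq_sub_iff_add_eq.2 h2]
  refine (abs_sub _ _).trans ?_
  linarith [hz J v hv, hz J u hu]

namespace DiagIFS

variable (Φ : DiagIFS d A)

theorem antitone_filter_lt (N : Fin d → ℕ) :
    Antitone fun n : ℕ => Finset.univ.filter fun i => n < N i :=
  fun _ _ hmn => Finset.monotone_filter_right _ fun _ _ h => lt_of_le_of_lt hmn h

/-- The information content of the approximate square around `ω` with depths `N`. -/
noncomputable def squareInfo (q : ℕ → Φ.Symb → ℝ) (N : Fin d → ℕ) (ω : ℕ → Φ.Symb) : ℝ :=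
  ∑ n ∈ Finset.range (Finset.univ.sup N),
    -Real.log (Φ.cylMass (Finset.univ.filter fun i => n < N i) (q n) (ω n))

theorem squareInfo_eq {q : ℕ → Φ.Symb → ℝ} (hq : ∀ n, IsProbVec (q n)) {N : Fin d → ℕ} {K : ℕ}
    (hK : ∀ i, N i ≤ K) (ω : ℕ → Φ.Symb) :
    Φ.squareInfo q N ω = ∑ n ∈ Finset.range K,
      -Real.log (Φ.cylMass (Finset.univ.filter fun i => n < N i) (q n) (ω n)) := by
  refine Finset.sum_subset (Finset.range_subset_range.2 (Finset.sup_le fun i _ => hK i))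
    fun n _ hn => ?_
  have hempty : (Finset.univ.filter fun i => n < N i) = ∅ := by
    refine Finset.filter_eq_empty_iff.2 fun i _ => ?_
    have := Finset.le_sup (f := N) (Finset.mem_univ i)
    simp only [Finset.mem_range, not_lt] at hn ⊢
    exact this.trans hn
  rw [hempty, Φ.cylMass_empty (hq n), Real.log_one, neg_zero]

/-- Minus the logarithm of the contraction ratio of the first `N` symbols in coordinate `i`. -/
noncomputable def logSize (ω : ℕ → Φ.Symb) (i : Fin d) (N : ℕ) : ℝ :=
  ∑ n ∈ Finset.range N, -Real.log |Φ.slope i ((ω n).1 i)|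

/-- The first depth at which the cylinder in coordinate `i` has size at most `exp (-B)`. -/
noncomputable def cutoff (ω : ℕ → Φ.Symb) (B : ℝ) (i : Fin d) : ℕ :=
  sInf {N : ℕ | B ≤ Φ.logSize ω i N}

variable {Φ} {m M : ℝ}

theorem mul_le_logSize (hmM : ∀ i a, m ≤ -Real.log |Φ.slope i a| ∧
    -Real.log |Φ.slope i a| ≤ M) (ω : ℕ → Φ.Symb) (i : Fin d) (N : ℕ) :
    m * N ≤ Φ.logSize ω i N := by
  have := Finset.sum_le_sum fun n (_ : n ∈ Finset.range N) => (hmM i ((ω n).1 i)).1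
  simpa [logSize, mul_comm] using this

theorem cutoff_spec (hm : 0 < m) (hM : 0 < M) (hmM : ∀ i a, m ≤ -Real.log |Φ.slope i a| ∧
    -Real.log |Φ.slope i a| ≤ M) (ω : ℕ → Φ.Symb) {B : ℝ} (hB : 0 ≤ B) (i : Fin d) :
    B ≤ Φ.logSize ω i (Φ.cutoff ω B i) ∧ Φ.logSize ω i (Φ.cutoff ω B i) ≤ B + M ∧
      Φ.cutoff ω B i ≤ ⌈B / m⌉₊ := by
  have hmem : ⌈B / m⌉₊ ∈ {N : ℕ | B ≤ Φ.logSize ω i N} := by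
    refine le_trans ?_ (mul_le_logSize hmM ω i _)
    have := Nat.le_ceil (B / m)
    rwa [div_le_iff₀' hm] at this
  refine ⟨Nat.sInf_mem ⟨_, hmem⟩, ?_, Nat.sInf_le hmem⟩
  rcases h : Φ.cutoff ω B i with _ | k
  · simp only [logSize, Finset.range_zero, Finset.sum_empty]; positivity
  · have hk : k ∉ {N : ℕ | B ≤ Φ.logSize ω i N} :=
      Nat.notMem_of_lt_sInf (lt_of_lt_of_eq k.lt_succ_self h.symm)
    simp only [mem_ofPred_eq, not_le] at hk
    have h2 := (hmM i ((ω k).1 i)).2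
    rw [logSize, Finset.sum_range_succ]
    rw [logSize] at hk
    linarith

end DiagIFS

namespace Cycle

variable {Φ : DiagIFS d A} (c : Cycle Φ)

theorem exists_entropy_bound (hl : 1 < c.lam) :
    ∃ C, 0 ≤ C ∧ ∀ I, ∀ b > 0, |Φ.entropy I (c.r b)| ≤ C := by
  choose C hC0 hC using fun I => (c.mulPeriodic_comp (Φ.continuous_entropy I)).exists_bound hl
  refine ⟨∑ I, C I, Finset.sum_nonneg fun I _ => hC0 I, fun I b hb => (hC I b hb).trans ?_⟩
  exact Finset.single_le_sum (fun J _ => hC0 J) (Finset.mem_univ I)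

theorem integrableOn_entropy_threshold (hl : 1 < c.lam) (t : Fin d → ℝ) :
    IntegrableOn (fun b => Φ.entropy (Finset.univ.filter fun i => b ≤ t i) (c.r b))
      (Ioi (0 : ℝ)) := by
  obtain ⟨C, hC0, hC⟩ := c.exists_entropy_bound hl
  have hmeas : AEStronglyMeasurable
      (fun b => Φ.entropy (Finset.univ.filter fun i => b ≤ t i) (c.r b))
      (volume.restrict (Ioi (0 : ℝ))) := by
    have heq : (fun b => Φ.entropy (Finset.univ.filter fun i => b ≤ t i) (c.r b))
        = fun b => ∑ I : Finset (Fin d), Set.indicator {b | ∀ i, b ≤ t i ↔ i ∈ I}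
          (fun b => Φ.entropy I (c.r b)) b := by
      funext b
      rw [Finset.sum_eq_single (Finset.univ.filter fun i => b ≤ t i)]
      · rw [Set.indicator_of_mem]
        intro i
        simp
      · intro I _ hI
        refine Set.indicator_of_notMem (fun h => hI ?_) _
        ext i
        simp [← h i]
      · simp
    rw [heq]
    refine Finset.aestronglyMeasurable_fun_sum _ fun I _ => ?_
    refine AEStronglyMeasurable.indicator ?_ ?_
    · exact (c.mulPeriodic_comp (Φ.continuous_entropy I)).cont.aestronglyMeasurable
        measurableSet_Ioi
    · rw [show {b | ∀ i, b ≤ t i ↔ i ∈ I} = ⋂ i, {b | b ≤ t i ↔ i ∈ I} by ext; simp]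
      refine MeasurableSet.iInter fun i => ?_
      by_cases hi : i ∈ I
      · have : {b | b ≤ t i ↔ i ∈ I} = Iic (t i) := by ext; simp [hi]
        exact this ▸ measurableSet_Iic
      · have : {b | b ≤ t i ↔ i ∈ I} = Ioi (t i) := by ext; simp [hi]
        exact this ▸ measurableSet_Ioi
  set K := ∑ i, |t i| with hK
  have htK : ∀ i, t i ≤ K := fun i => (le_abs_self _).trans
    (Finset.single_le_sum (f := fun i => |t i|) (fun i _ => abs_nonneg _) (Finset.mem_univ i))
  have h1 : IntegrableOn (fun b => Φ.entropy (Finset.univ.filter fun i => b ≤ t i) (c.r b))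
      (Ioc 0 K) := by
    refine Integrable.of_bound (hmeas.mono_measure (Measure.restrict_mono Ioc_subset_Ioi_self
      le_rfl)) C ?_
    exact (ae_restrict_mem measurableSet_Ioc).mono fun b hb => hC _ b hb.1
  refine h1.of_forall_sdiff_eq_zero measurableSet_Ioi fun b hb => ?_
  have hb0 : 0 < b := hb.1
  have hbK : K < b := by
    by_contra! h
    exact hb.2 ⟨hb0, h⟩
  have : (Finset.univ.filter fun i => b ≤ t i) = ∅ :=
    Finset.filter_eq_empty_iff.2 fun i _ => not_le.2 ((htK i).trans_lt hbK)
  rw [this, Φ.entropy_empty (c.prob b hb0)]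

/-- The entropy integral is Lipschitz in the thresholds. -/
theorem exists_entropyIntegral_lipschitz (hl : 1 < c.lam) :
    ∃ C, 0 ≤ C ∧ ∀ t t' : Fin d → ℝ,
      |Φ.entropyIntegral c.r t - Φ.entropyIntegral c.r t'| ≤ C * ∑ i, |t i - t' i| := by
  obtain ⟨C, hC0, hC⟩ := c.exists_entropy_bound hl
  refine ⟨2 * C, by positivity, fun t t' => ?_⟩
  rw [DiagIFS.entropyIntegral, DiagIFS.entropyIntegral,
    ← integral_sub (c.integrableOn_entropy_threshold hl t)
      (c.integrableOn_entropy_threshold hl t')]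
  have hint : ∀ i, Integrable (Set.indicator (Set.uIoc (t' i) (t i)) fun _ => (1 : ℝ)) := by
    intro i
    rw [integrable_indicator_iff measurableSet_uIoc]
    simp [Set.uIoc]
  have hI : Integrable (fun b => 2 * C *
      ∑ i, Set.indicator (Set.uIoc (t' i) (t i)) (fun _ => (1 : ℝ)) b) :=
    (integrable_finsetSum _ fun i _ => hint i).const_mul _
  have hle := norm_integral_le_of_norm_le (μ := volume.restrict (Ioi (0 : ℝ)))
    (f := fun b => Φ.entropy (Finset.univ.filter fun i => b ≤ t i) (c.r b)
      - Φ.entropy (Finset.univ.filter fun i => b ≤ t' i) (c.r b)) hI.integrableOn ?_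
  · refine hle.trans ?_
    refine (setIntegral_le_integral hI (Eventually.of_forall fun b => ?_)).trans ?_
    · exact mul_nonneg (by positivity) (Finset.sum_nonneg fun i _ =>
        Set.indicator_nonneg (fun _ _ => zero_le_one) _)
    · rw [integral_const_mul, integral_finsetSum _ fun i _ => hint i]
      refine mul_le_mul_of_nonneg_left (Finset.sum_le_sum fun i _ => ?_) (by positivity)
      rw [integral_indicator measurableSet_uIoc]
      simp [Set.uIoc, abs_sub_comm, max_sub_min_eq_abs']
  · refine (ae_restrict_mem measurableSet_Ioi).mono fun b hb => ?_
    have hb0 : 0 < b := hb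
    by_cases h : ∀ i, b ∉ Set.uIoc (t' i) (t i)
    · have : (Finset.univ.filter fun i => b ≤ t i) = Finset.univ.filter fun i => b ≤ t' i := by
        refine Finset.filter_congr fun i _ => ?_
        have := h i
        rw [Set.mem_uIoc] at this
        grind
      rw [this, sub_self, norm_zero]
      exact mul_nonneg (by positivity) (Finset.sum_nonneg fun i _ =>
        Set.indicator_nonneg (fun _ _ => zero_le_one) _)
    · push Not at h
      obtain ⟨i, hi⟩ := h
      have h1 : (1 : ℝ) ≤ ∑ i, Set.indicator (Set.uIoc (t' i) (t i)) (fun _ => (1 : ℝ)) b := by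
        have := Finset.single_le_sum
          (f := fun i => Set.indicator (Set.uIoc (t' i) (t i)) (fun _ => (1 : ℝ)) b)
          (fun i _ => Set.indicator_nonneg (fun _ _ => zero_le_one) _) (Finset.mem_univ i)
        simpa [Set.indicator_of_mem hi] using this
      refine (norm_sub_le _ _).trans ?_
      have h2 := hC (Finset.univ.filter fun i => b ≤ t i) b hb0
      have h3 := hC (Finset.univ.filter fun i => b ≤ t' i) b hb0
      simp only [Real.norm_eq_abs]
      nlinarith

theorem entropyIntegral_natCast (hl : 1 < c.lam) {N : Fin d → ℕ} {K : ℕ} (hK : ∀ i, N i ≤ K) :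
    Φ.entropyIntegral c.r (fun i => (N i : ℝ)) = ∑ n ∈ Finset.range K,
      ∫ b in (n : ℝ)..(n + 1),
        Φ.entropy (Finset.univ.filter fun i => n < N i) (c.r b) := by
  have hint := c.integrableOn_entropy_threshold hl (fun i => (N i : ℝ))
  rw [DiagIFS.entropyIntegral]
  have h1 : ∫ b in Ioi (0 : ℝ),
        Φ.entropy (Finset.univ.filter fun i => b ≤ (N i : ℝ)) (c.r b)
      = ∫ b in Ioc (0 : ℝ) K,
        Φ.entropy (Finset.univ.filter fun i => b ≤ (N i : ℝ)) (c.r b) := by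
    refine setIntegral_eq_of_subset_of_forall_sdiff_eq_zero measurableSet_Ioi
      Ioc_subset_Ioi_self fun b hb => ?_
    have hb0 : 0 < b := hb.1
    have hbK : (K : ℝ) < b := by
      by_contra! h
      exact hb.2 ⟨hb0, h⟩
    have : (Finset.univ.filter fun i => b ≤ (N i : ℝ)) = ∅ :=
      Finset.filter_eq_empty_iff.2 fun i _ => not_le.2 (lt_of_le_of_lt (by
        exact_mod_cast hK i) hbK)
    rw [this, Φ.entropy_empty (c.prob b hb0)]
  rw [h1, ← intervalIntegral.integral_of_le (by positivity)]
  have h2 := intervalIntegral.sum_integral_adjacent_intervals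
    (f := fun b => Φ.entropy (Finset.univ.filter fun i => b ≤ (N i : ℝ)) (c.r b))
    (μ := volume) (a := fun k : ℕ => (k : ℝ)) (n := K) (fun k _ => by
      rw [intervalIntegrable_iff_integrableOn_Ioc_of_le (by simp)]
      exact hint.mono_set fun b hb => lt_of_le_of_lt (by positivity) hb.1)
  simp only [Nat.cast_zero] at h2
  rw [← h2]
  refine Finset.sum_congr rfl fun n _ => ?_
  rw [intervalIntegral.integral_of_le (by simp), intervalIntegral.integral_of_le (by simp)]
  push_cast
  refine setIntegral_congr_fun measurableSet_Ioc fun b hb => ?_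
  have : (Finset.univ.filter fun i => b ≤ (N i : ℝ)) = Finset.univ.filter fun i => n < N i := by
    refine Finset.filter_congr fun i _ => ⟨fun h => ?_, fun h => ?_⟩
    · exact_mod_cast hb.1.trans_le h
    · refine hb.2.trans ?_
      exact_mod_cast h
  simp only [this]

/-- Along a word obeying the laws of large numbers, the information content of the approximate
square of size `exp (-B)` is asymptotic to `B * δ(r, B)`. -/
theorem eventually_abs_squareInfo_sub_le (hl : 1 < c.lam) (hV : Φ.Valid) {ω : ℕ → Φ.Symb}
    (hX : ∀ I, Tendsto (fun N : ℕ =>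
      (∑ n ∈ Finset.range N, -Real.log (Φ.cylMass I (c.r (n + 1)) (ω n))
        - ∑ n ∈ Finset.range N, Φ.entropy I (c.r (n + 1))) / N) atTop (𝓝 0))
    (hY : ∀ i, Tendsto (fun N : ℕ =>
      (Φ.logSize ω i N - ∑ n ∈ Finset.range N, Φ.chi i (c.r (n + 1))) / N) atTop (𝓝 0))
    {ε : ℝ} (hε : 0 < ε) :
    ∀ᶠ B : ℝ in atTop, |Φ.squareInfo (fun n => c.r (n + 1)) (Φ.cutoff ω B) ω
      - B * deltaRB Φ c.r B| ≤ ε * B := by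
  obtain ⟨m, M, hm, hM, hmM⟩ := hV.exists_rate_bounds
  obtain ⟨C, hC0, hC⟩ := c.exists_entropyIntegral_lipschitz hl
  set z : Finset (Fin d) → ℕ → ℝ := fun I n => -Real.log (Φ.cylMass I (c.r (n + 1)) (ω n))
    - ∫ b in (n : ℝ)..(n + 1), Φ.entropy I (c.r b) with hz
  have hGI := fun I => c.mulPeriodic_comp (Φ.continuous_entropy I)
  have hGi := fun i => c.mulPeriodic_comp (Φ.continuous_chi i)
  have hzlim : ∀ I, Tendsto (fun N : ℕ => (∑ n ∈ Finset.range N, z I n) / N) atTop (𝓝 0) := by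
    intro I
    have h := (hX I).add ((hGI I).tendsto_sum_sub_integral_div hl)
    rw [add_zero] at h
    refine h.congr fun N => ?_
    have hs := intervalIntegral.sum_integral_adjacent_intervals
      (f := fun b => Φ.entropy I (c.r b)) (μ := volume) (a := fun k : ℕ => (k : ℝ)) (n := N)
      (fun k _ => (hGI I).intervalIntegrable hl (by positivity) (by positivity))
    simp only [Nat.cast_add, Nat.cast_one, Nat.cast_zero] at hs
    simp only [hz]
    rw [Finset.sum_sub_distrib, hs]
    ring
  have hylim : ∀ i, Tendsto (fun N : ℕ => (Φ.logSize ω i N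
      - ∫ b in (0 : ℝ)..N, Φ.chi i (c.r b)) / N) atTop (𝓝 0) := by
    intro i
    have h := (hY i).add ((hGi i).tendsto_sum_sub_integral_div hl)
    rw [add_zero] at h
    refine h.congr fun N => ?_
    ring
  set Q : ℝ := 2 ^ d * 2 + C * (d * m⁻¹) with hQ
  have hQ0 : 0 < Q := by positivity
  set η : ℝ := ε / (2 * Q * (m⁻¹ + 2)) with hη
  have hη0 : 0 < η := by positivity
  have hK1 := eventually_all.2 fun I =>
    eventually_forall_abs_le_of_tendsto_div (by simp) (hzlim I) hη0
  have hK2 := eventually_all.2 fun i =>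
    eventually_forall_abs_le_of_tendsto_div (by simp [DiagIFS.logSize]) (hylim i) hη0
  have hKt : Tendsto (fun B : ℝ => ⌈B / m⌉₊) atTop atTop :=
    tendsto_nat_ceil_atTop.comp (tendsto_id.atTop_div_const hm)
  filter_upwards [hKt.eventually hK1, hKt.eventually hK2, eventually_ge_atTop 1,
    eventually_ge_atTop (2 * (C * (d * m⁻¹) * M) / ε)] with B h1 h2 hB1 hB2
  have hB0 : 0 < B := zero_lt_one.trans_le hB1
  set K := ⌈B / m⌉₊ with hK
  set N := Φ.cutoff ω B with hN
  have hNspec := fun i => DiagIFS.cutoff_spec hm hM hmM ω hB0.le i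
  have hNK : ∀ i, N i ≤ K := fun i => (hNspec i).2.2
  have hinfo := Φ.squareInfo_eq (q := fun n => c.r (n + 1))
    (fun n => c.prob _ (by positivity)) hNK ω
  have hKB : (K : ℝ) ≤ (m⁻¹ + 2) * B := by
    have h := Nat.ceil_lt_add_one (a := B / m) (by positivity)
    have h' : B / m = m⁻¹ * B := by rw [div_eq_mul_inv, mul_comm]
    linarith
  have e1 : |Φ.squareInfo (fun n => c.r (n + 1)) N ω
      - Φ.entropyIntegral c.r (fun i => (N i : ℝ))| ≤ 2 ^ d * (2 * (η * K)) := by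
    rw [hinfo, c.entropyIntegral_natCast hl hNK, ← Finset.sum_sub_distrib]
    exact abs_sum_antitone_le (z := z) (DiagIFS.antitone_filter_lt N) h1
  have e2 : ∀ i, |(N i : ℝ) - Bcoord Φ c.r B i| ≤ m⁻¹ * (η * K + M) := by
    intro i
    obtain ⟨hb0, hbB⟩ := c.Bcoord_spec hl hV hB0.le i
    have hlow : ∀ b > 0, m ≤ Φ.chi i (c.r b) := fun b hb =>
      (Φ.chi_mem_Icc hmM i (c.prob b hb)).1
    have h3 := h2 i (N i) (hNK i)
    obtain ⟨h4, h5, -⟩ := hNspec i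
    rw [← hN] at h4 h5
    have h6 : |(∫ b in (0 : ℝ)..(N i), Φ.chi i (c.r b)) - B| ≤ η * K + M := by
      rw [abs_le] at h3 ⊢
      constructor <;> linarith [h3.1, h3.2]
    rw [← div_eq_inv_mul, le_div_iff₀ hm]
    refine le_trans ?_ h6
    have hN0 : (0 : ℝ) ≤ N i := by positivity
    nth_rewrite 2 [← hbB]
    rw [(hGi i).integral_sub hl hb0 hN0]
    rcases le_total (Bcoord Φ c.r B i) (N i) with hle | hle
    · have h7 := (hGi i).mul_le_integral hl hlow hb0 hle
      rw [abs_of_nonneg (sub_nonneg.2 hle)]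
      refine le_trans ?_ (le_abs_self _)
      linarith
    · have h7 := (hGi i).mul_le_integral hl hlow hN0 hle
      rw [abs_sub_comm, abs_of_nonneg (sub_nonneg.2 hle), intervalIntegral.integral_symm, abs_neg]
      refine le_trans ?_ (le_abs_self _)
      linarith
  have e3 := hC (fun i => (N i : ℝ)) (Bcoord Φ c.r B)
  have e4 : ∑ i, |(N i : ℝ) - Bcoord Φ c.r B i| ≤ d * (m⁻¹ * (η * K + M)) := by
    have := Finset.sum_le_sum fun i (_ : i ∈ Finset.univ) => e2 i
    simpa using this
  have e5 : B * deltaRB Φ c.r B = Φ.entropyIntegral c.r (Bcoord Φ c.r B) := by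
    rw [deltaRB_eq]; field_simp
  rw [e5]
  have e6 : C * (d * m⁻¹) * M ≤ ε / 2 * B := by
    rw [div_le_iff₀ hε] at hB2
    linarith
  have e7 : Q * (η * K) ≤ ε / 2 * B := by
    calc Q * (η * K) ≤ Q * (η * ((m⁻¹ + 2) * B)) := by gcongr
      _ = ε / 2 * B := by rw [hη]; field_simp
  have e8 := mul_le_mul_of_nonneg_left e4 hC0
  have e9 := abs_sub_le (Φ.squareInfo (fun n => c.r (n + 1)) N ω)
    (Φ.entropyIntegral c.r (fun i => (N i : ℝ))) (Φ.entropyIntegral c.r (Bcoord Φ c.r B))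
  rw [hQ] at e7
  linarith

end Cycle

namespace IsProductMeasure

variable {Φ : DiagIFS d A} {q : ℕ → Φ.Symb → ℝ} {μ : Measure (ℕ → Φ.Symb)}

/-- The mass of an approximate square. -/
theorem real_square (hμ : IsProductMeasure Φ q μ) (hq : ∀ n, IsProbVec (q n)) (N : Fin d → ℕ)
    {ω : ℕ → Φ.Symb} (hω : ∀ n, 0 < q n (ω n)) :
    μ.real {τ | ∀ i, ∀ n < N i, (τ n).1 i = (ω n).1 i} = Real.exp (-Φ.squareInfo q N ω) := by
  have hset : {τ : ℕ → Φ.Symb | ∀ i, ∀ n < N i, (τ n).1 i = (ω n).1 i}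
      = {τ | ∀ n ∈ Finset.range (Finset.univ.sup N), τ n ∈ (Finset.univ.filter
        fun b : Φ.Symb => ∀ i ∈ Finset.univ.filter fun i => n < N i, b.1 i = (ω n).1 i)} := by
    ext τ
    simp only [mem_ofPred_eq, Finset.mem_range, Finset.mem_filter, Finset.mem_univ, true_and]
    refine ⟨fun h n _ i hi => h i n hi, fun h i n hn => h n ?_ i hn⟩
    exact hn.trans_le (Finset.le_sup (f := N) (Finset.mem_univ i))
  rw [hset, hμ.real_box hq, DiagIFS.squareInfo, Finset.sum_neg_distrib, neg_neg, Real.exp_sum]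
  refine Finset.prod_congr rfl fun n _ => ?_
  rw [Real.exp_log ((hω n).trans_le (Φ.le_cylMass (hq n) _ _)), DiagIFS.cylMass,
    Finset.sum_filter]

theorem ae_forall_eventually_squareInfo {c : Cycle Φ} (hl : 1 < c.lam) (hV : Φ.Valid)
    (hμ : IsProductMeasure Φ (fun n => c.r (n + 1)) μ) :
    ∀ᵐ ω ∂μ, ∀ ε > 0, ∀ᶠ B : ℝ in atTop,
      |Φ.squareInfo (fun n => c.r (n + 1)) (Φ.cutoff ω B) ω - B * deltaRB Φ c.r B| ≤ ε * B := by
  have hq : ∀ n : ℕ, IsProbVec (c.r (n + 1)) := fun n => c.prob _ (by positivity)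
  obtain ⟨m, M, hm, hM, hmM⟩ := hV.exists_rate_bounds
  have h1 : ∀ I, ∀ᵐ ω ∂μ, Tendsto (fun N : ℕ =>
      (∑ n ∈ Finset.range N, -Real.log (Φ.cylMass I (c.r (n + 1)) (ω n))
        - ∑ n ∈ Finset.range N, Φ.entropy I (c.r (n + 1))) / N) atTop (𝓝 0) := fun I => by
    simp only [Φ.entropy_eq_sum]
    exact hμ.strong_law hq (fun n a => -Real.log (Φ.cylMass I (c.r (n + 1)) a))
      (fun n a => Φ.neg_log_cylMass_nonneg (hq n) I a) _
      (fun n => Φ.sum_mul_neg_log_cylMass_sq_le (hq n) I)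
  have h2 : ∀ i, ∀ᵐ ω ∂μ, Tendsto (fun N : ℕ =>
      (Φ.logSize ω i N - ∑ n ∈ Finset.range N, Φ.chi i (c.r (n + 1))) / N) atTop (𝓝 0) := by
    intro i
    have := hμ.strong_law hq (fun _ a => -Real.log |Φ.slope i (a.1 i)|)
      (fun n a => hm.le.trans (hmM i _).1) (M ^ 2) fun n => ?_
    · simpa only [DiagIFS.chi, DiagIFS.logSize, mul_neg, Finset.sum_neg_distrib] using this
    · calc _ ≤ ∑ a, c.r (n + 1) a * M ^ 2 := Finset.sum_le_sum fun a _ =>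
            mul_le_mul_of_nonneg_left (pow_le_pow_left₀ (hm.le.trans (hmM i _).1) (hmM i _).2 2)
              ((hq n).1 a)
        _ = M ^ 2 := by rw [← Finset.sum_mul, (hq n).2, one_mul]
  filter_upwards [ae_all_iff.2 h1, ae_all_iff.2 h2] with ω hX hY ε hε
  exact c.eventually_abs_squareInfo_sub_le hl hV hX hY hε

end IsProductMeasure

namespace DiagIFS

variable {Φ : DiagIFS d A}

theorem base_eq_add_mul (Φ : DiagIFS d A) (i : Fin d) (a : A i) (x y : ℝ) :
    Φ.base i a x = Φ.base i a y + Φ.slope i a * (x - y) := by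
  simp only [base]; ring

theorem base_sub_base (Φ : DiagIFS d A) (i : Fin d) (a : A i) (x y : ℝ) :
    Φ.base i a x - Φ.base i a y = Φ.slope i a * (x - y) := by
  simp only [base]; ring

theorem continuous_base (Φ : DiagIFS d A) (i : Fin d) (a : A i) : Continuous (Φ.base i a) := by
  unfold base; fun_prop

theorem logSize_succ (ω : ℕ → Φ.Symb) (i : Fin d) (N : ℕ) :
    Φ.logSize ω i (N + 1) = Φ.logSize (shift ω) i N - Real.log |Φ.slope i ((ω 0).1 i)| := by
  rw [logSize, Finset.sum_range_succ', logSize]; rfl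

namespace Valid

theorem exp_neg_logSize (hV : Φ.Valid) (ω : ℕ → Φ.Symb) (i : Fin d) (N : ℕ) :
    |∏ k ∈ Finset.range N, Φ.slope i ((ω k).1 i)| = Real.exp (-Φ.logSize ω i N) := by
  rw [Finset.abs_prod, logSize, Finset.sum_neg_distrib, neg_neg, Real.exp_sum]
  exact Finset.prod_congr rfl fun n _ => (Real.exp_log (abs_pos.2 (hV.2.1 i _))).symm

theorem exp_neg_logSize_succ (hV : Φ.Valid) (ω : ℕ → Φ.Symb) (i : Fin d) (N : ℕ) :
    Real.exp (-Φ.logSize ω i (N + 1))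
      = |Φ.slope i ((ω 0).1 i)| * Real.exp (-Φ.logSize (shift ω) i N) := by
  rw [logSize_succ, neg_sub, sub_eq_add_neg, Real.exp_add, Real.exp_log (abs_pos.2 (hV.2.1 i _))]

theorem off_mem (hV : Φ.Valid) (i : Fin d) (a : A i) : Φ.off i a ∈ Icc (0 : ℝ) 1 := by
  simpa [base] using hV.2.2.2 i a 0 (by simp)

theorem exists_abs_term_le (hV : Φ.Valid) : ∃ θ : ℝ, 0 ≤ θ ∧ θ < 1 ∧
    ∀ (ω : ℕ → Φ.Symb) (i : Fin d) (n : ℕ),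
    ‖(∏ k ∈ Finset.range n, Φ.slope i ((ω k).1 i)) * Φ.off i ((ω n).1 i)‖ ≤ θ ^ n := by
  obtain ⟨m, M, hm, hM, hmM⟩ := hV.exists_rate_bounds
  refine ⟨Real.exp (-m), (Real.exp_pos _).le, Real.exp_lt_one_iff.2 (neg_lt_zero.2 hm),
    fun ω i n => ?_⟩
  have h1 := hV.off_mem i ((ω n).1 i)
  rw [norm_mul, Real.norm_eq_abs, Real.norm_eq_abs, abs_of_nonneg h1.1, hV.exp_neg_logSize,
    ← Real.exp_nat_mul]
  refine (mul_le_of_le_one_right (Real.exp_pos _).le h1.2).trans (Real.exp_le_exp.2 ?_)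
  have := mul_le_logSize hmM ω i n
  linarith

theorem summable_coding (hV : Φ.Valid) (ω : ℕ → Φ.Symb) (i : Fin d) : Summable fun n =>
    (∏ k ∈ Finset.range n, Φ.slope i ((ω k).1 i)) * Φ.off i ((ω n).1 i) := by
  obtain ⟨θ, h0, h1, h⟩ := hV.exists_abs_term_le
  exact Summable.of_norm_bounded (summable_geometric_of_lt_one h0 h1) (h ω i)

theorem continuous_coding (hV : Φ.Valid) : Continuous Φ.coding := by
  obtain ⟨θ, h0, h1, h⟩ := hV.exists_abs_term_le
  refine continuous_pi fun i => ?_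
  refine continuous_tsum (fun n => ?_) (summable_geometric_of_lt_one h0 h1) fun n ω => h ω i n
  have hc : ∀ (f : Φ.Symb → ℝ) (k : ℕ), Continuous fun ω : ℕ → Φ.Symb => f (ω k) := fun f k =>
    continuous_of_discreteTopology.comp (continuous_apply k)
  exact (continuous_finsetProd _ fun k _ => hc (fun a => Φ.slope i (a.1 i)) k).mul
    (hc (fun a => Φ.off i (a.1 i)) n)

theorem coding_eq_base (hV : Φ.Valid) (ω : ℕ → Φ.Symb) (i : Fin d) :
    Φ.coding ω i = Φ.base i ((ω 0).1 i) (Φ.coding (shift ω) i) := by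
  rw [coding, (hV.summable_coding ω i).tsum_eq_zero_add, base, coding, ← tsum_mul_left,
    Finset.prod_range_zero, one_mul, add_comm]
  congr 1
  refine tsum_congr fun n => ?_
  rw [Finset.prod_range_succ', mul_comm (∏ k ∈ Finset.range n, _), mul_assoc]
  rfl

theorem sum_coding_mem (hV : Φ.Valid) (i : Fin d) (N : ℕ) (ω : ℕ → Φ.Symb) : ∑ n ∈ Finset.range N,
    (∏ k ∈ Finset.range n, Φ.slope i ((ω k).1 i)) * Φ.off i ((ω n).1 i) ∈ Icc (0 : ℝ) 1 := by
  induction N generalizing ω with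
  | zero => simp
  | succ N ih =>
    convert hV.2.2.2 i ((ω 0).1 i) _ (ih (shift ω)) using 1
    rw [Finset.sum_range_succ', base, Finset.mul_sum, Finset.prod_range_zero, one_mul]
    congr 1
    refine Finset.sum_congr rfl fun n _ => ?_
    rw [Finset.prod_range_succ', mul_comm (∏ k ∈ Finset.range n, _), mul_assoc]
    rfl

theorem coding_mem_Icc (hV : Φ.Valid) (ω : ℕ → Φ.Symb) (i : Fin d) : Φ.coding ω i ∈ Icc (0 : ℝ) 1 :=
  isClosed_Icc.mem_of_tendsto (hV.summable_coding ω i).hasSum.tendsto_sum_nat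
    (Eventually.of_forall fun N => hV.sum_coding_mem i N ω)

/-- Words sharing `N` initial symbols in coordinate `i` have nearby codings in that coordinate. -/
theorem abs_coding_sub_le (hV : Φ.Valid) {ω τ : ℕ → Φ.Symb} {i : Fin d} {N : ℕ}
    (h : ∀ n < N, (τ n).1 i = (ω n).1 i) :
    |Φ.coding τ i - Φ.coding ω i| ≤ Real.exp (-Φ.logSize ω i N) := by
  induction N generalizing ω τ with
  | zero =>
    have h1 := hV.coding_mem_Icc ω i
    have h2 := hV.coding_mem_Icc τ i
    simp only [logSize, Finset.range_zero, Finset.sum_empty, neg_zero, Real.exp_zero, abs_le]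
    constructor <;> linarith [h1.1, h1.2, h2.1, h2.2]
  | succ N ih =>
    rw [hV.coding_eq_base ω, hV.coding_eq_base τ, h 0 N.succ_pos, base_sub_base, abs_mul,
      hV.exp_neg_logSize_succ]
    exact mul_le_mul_of_nonneg_left (ih fun n hn => h (n + 1) (Nat.succ_lt_succ hn)) (abs_nonneg _)

end Valid

/-- The distance from a point of `[0,1]` to one of the endpoints. -/
def endDist (e : Bool) (z : ℝ) : ℝ := bif e then 1 - z else z

theorem endDist_nonneg {e : Bool} {z : ℝ} (hz : z ∈ Icc (0 : ℝ) 1) : 0 ≤ endDist e z := by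
  cases e
  · exact hz.1
  · exact sub_nonneg.2 hz.2

theorem Valid.mul_endDist_le (hV : Φ.Valid) (i : Fin d) (a : A i) (e : Bool) :
    ∃ e', ∀ w, |Φ.slope i a| * endDist e' w ≤ endDist e (Φ.base i a w) := by
  have h0 := hV.2.2.2 i a 0 (by simp)
  have h1 := hV.2.2.2 i a 1 (by simp)
  simp only [base, mul_zero, zero_add, mul_one, mem_Icc] at h0 h1
  rcases le_total 0 (Φ.slope i a) with hs | hs
  · refine ⟨e, fun w => ?_⟩
    rw [abs_of_nonneg hs]
    cases e <;> simp only [endDist, base, cond_true, cond_false] <;> linarith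
  · refine ⟨!e, fun w => ?_⟩
    rw [abs_of_nonpos hs]
    cases e <;> simp only [endDist, base, Bool.not_true, Bool.not_false, cond_true, cond_false] <;>
      linarith

/-- The distance from a point of `[0,1]` to the boundary. -/
def edgeDist (z : ℝ) : ℝ := min z (1 - z)

theorem edgeDist_eq (z : ℝ) : edgeDist z = min (endDist false z) (endDist true z) := rfl

theorem edgeDist_le_endDist (e : Bool) (z : ℝ) : edgeDist z ≤ endDist e z := by
  cases e
  · exact min_le_left _ _
  · exact min_le_right _ _

theorem Valid.mul_edgeDist_le (hV : Φ.Valid) (i : Fin d) (a : A i) (w : ℝ) :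
    |Φ.slope i a| * edgeDist w ≤ edgeDist (Φ.base i a w) := by
  rw [edgeDist_eq (Φ.base i a w)]
  refine le_min ?_ ?_ <;>
  · obtain ⟨e', h⟩ := hV.mul_endDist_le i a _
    exact (mul_le_mul_of_nonneg_left (edgeDist_le_endDist e' w) (abs_nonneg _)).trans (h w)

theorem Baranski.base_notMem (hV : Φ.Valid) (hB : Φ.Baranski) {i : Fin d} {a b : A i} (hab : a ≠ b)
    {u w : ℝ} (hu : u ∈ Ioo (0 : ℝ) 1) (hw : w ∈ Icc (0 : ℝ) 1) :
    Φ.base i a u ≠ Φ.base i b w := by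
  intro h
  have hopen : IsOpen (Φ.base i a '' Ioo (0 : ℝ) 1) := by
    have := ((Homeomorph.mulLeft₀ _ (hV.2.1 i a)).trans
      (Homeomorph.addRight (Φ.off i a))).isOpenMap _ (isOpen_Ioo (a := (0 : ℝ)) (b := 1))
    exact this
  refine Set.disjoint_left.1 ((hB i a b hab).closure_right hopen) ⟨u, hu, rfl⟩ ?_
  rw [h]
  refine image_closure_subset_closure_image (Φ.continuous_base i b) ⟨w, ?_, rfl⟩
  rwa [closure_Ioo zero_ne_one]

theorem Baranski.mul_edgeDist_le_abs_sub (hV : Φ.Valid) (hB : Φ.Baranski) {i : Fin d} {a b : A i}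
    (hab : a ≠ b) (w : ℝ) {w' : ℝ} (hw' : w' ∈ Icc (0 : ℝ) 1) :
    |Φ.slope i a| * edgeDist w ≤ |Φ.base i b w' - Φ.base i a w| := by
  by_contra! h
  set u := w + (Φ.base i b w' - Φ.base i a w) / Φ.slope i a with hu
  have hs := hV.2.1 i a
  have hdist : |u - w| < edgeDist w := by
    rw [hu, add_sub_cancel_left, abs_div, div_lt_iff₀ (abs_pos.2 hs), mul_comm]
    exact h
  have h1 := (abs_lt.1 (hdist.trans_le (min_le_left _ _))).1
  have h2 := (abs_lt.1 (hdist.trans_le (min_le_right _ _))).2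
  refine hB.base_notMem hV hab (u := u) ⟨by linarith, by linarith⟩ hw' ?_
  rw [Φ.base_eq_add_mul i a u w, hu]
  field_simp
  ring

theorem Valid.exp_mul_edgeDist_le (hV : Φ.Valid) (i : Fin d) (N : ℕ) (ω : ℕ → Φ.Symb) :
    Real.exp (-Φ.logSize ω i N) * edgeDist (Φ.coding (shift^[N] ω) i)
      ≤ edgeDist (Φ.coding ω i) := by
  induction N generalizing ω with
  | zero => simp [logSize]
  | succ N ih =>
    rw [hV.coding_eq_base ω, hV.exp_neg_logSize_succ, mul_assoc]
    exact (mul_le_mul_of_nonneg_left (ih (shift ω)) (abs_nonneg _)).trans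
      (hV.mul_edgeDist_le i _ _)

/-- Words with different initial symbols in coordinate `i` have codings which are far from each
other, unless the tail of one of them is coded near the boundary. -/
theorem Baranski.le_abs_coding_sub (hV : Φ.Valid) (hB : Φ.Baranski) {ω τ : ℕ → Φ.Symb} {i : Fin d}
    {N : ℕ} (h : ∃ n < N, (τ n).1 i ≠ (ω n).1 i) :
    Real.exp (-Φ.logSize ω i N) * edgeDist (Φ.coding (shift^[N] ω) i)
      ≤ |Φ.coding τ i - Φ.coding ω i| := by
  induction N generalizing ω τ with
  | zero => simp at h
  | succ N ih =>
    rw [hV.coding_eq_base ω, hV.coding_eq_base τ, hV.exp_neg_logSize_succ, mul_assoc]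
    by_cases h0 : (τ 0).1 i = (ω 0).1 i
    · rw [h0, base_sub_base, abs_mul]
      refine mul_le_mul_of_nonneg_left (ih (ω := shift ω) (τ := shift τ) ?_) (abs_nonneg _)
      obtain ⟨n, hn, hne⟩ := h
      rcases n with _ | n
      · exact absurd h0 hne
      · exact ⟨n, Nat.lt_of_succ_lt_succ hn, hne⟩
    · exact (mul_le_mul_of_nonneg_left (hV.exp_mul_edgeDist_le i N (shift ω))
        (abs_nonneg _)).trans (hB.mul_edgeDist_le_abs_sub hV (Ne.symm h0) _
          (hV.coding_mem_Icc _ i))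

theorem continuous_endDist_base (Φ : DiagIFS d A) (i : Fin d) (a : A i) (e : Bool) :
    Continuous fun w => endDist e (Φ.base i a w) := by
  cases e
  · exact Φ.continuous_base i a
  · exact continuous_const.sub (Φ.continuous_base i a)

theorem endDist_base_half (Φ : DiagIFS d A) (i : Fin d) (a : A i) (e : Bool) :
    2 * endDist e (Φ.base i a (1 / 2)) = endDist e (Φ.base i a 0) + endDist e (Φ.base i a 1) := by
  cases e <;> simp only [endDist, base, cond_true, cond_false] <;> ring

theorem endDist_injective (e : Bool) : Function.Injective (endDist e) := by
  intro x y h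
  cases e <;> simp only [endDist, cond_true, cond_false] at h <;> linarith

theorem Valid.endDist_base_half_pos (hV : Φ.Valid) (i : Fin d) (a : A i) (e : Bool) :
    0 < endDist e (Φ.base i a (1 / 2)) := by
  have h0 := endDist_nonneg (e := e) (hV.2.2.2 i a 0 (by simp))
  have h1 := endDist_nonneg (e := e) (hV.2.2.2 i a 1 (by simp))
  have h := Φ.endDist_base_half i a e
  by_contra! hle
  have h2 : endDist e (Φ.base i a 0) = endDist e (Φ.base i a 1) := by linarith
  have h3 := Φ.base_sub_base i a 1 0
  rw [endDist_injective e h2, sub_self, sub_zero, mul_one] at h3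
  exact hV.2.1 i a h3.symm

theorem Baranski.endDist_half_lt (hV : Φ.Valid) (hB : Φ.Baranski) {i : Fin d} {a b : A i}
    (hab : a ≠ b) {e : Bool} {x : ℝ} (hx : x = 0 ∨ x = 1) (ha : endDist e (Φ.base i a x) = 0) :
    endDist e (Φ.base i a (1 / 2)) < endDist e (Φ.base i b (1 / 2)) := by
  by_contra! hle
  have hpos := hV.endDist_base_half_pos i b e
  obtain ⟨u, hu, hub⟩ := intermediate_value_uIcc
    (Φ.continuous_endDist_base i a e).continuousOn (a := x) (b := 1 / 2)
    (show endDist e (Φ.base i b (1 / 2)) ∈ _ from by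
      rw [ha, uIcc_of_le (hpos.le.trans hle)]; exact ⟨hpos.le, hle⟩)
  have hux : u ≠ x := by
    rintro rfl
    simp only at hub
    linarith
  refine hB.base_notMem hV hab (u := u) (w := 1 / 2) ?_ ⟨by norm_num, by norm_num⟩
    (endDist_injective e hub)
  rcases hx with rfl | rfl
  · rw [uIcc_of_le (by norm_num)] at hu
    exact ⟨lt_of_le_of_ne hu.1 (Ne.symm hux), by linarith [hu.2]⟩
  · rw [uIcc_of_ge (by norm_num)] at hu
    exact ⟨by linarith [hu.1], lt_of_le_of_ne hu.2 hux⟩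

/-- At most one of the base intervals contains a given endpoint of `[0,1]`. -/
theorem Baranski.exists_forall_ne_le_endDist (hV : Φ.Valid) (hB : Φ.Baranski) (i : Fin d)
    (e : Bool) : ∃ κ > 0, ∃ a₀ : A i, ∀ a ≠ a₀, ∀ w ∈ Icc (0 : ℝ) 1,
      κ ≤ endDist e (Φ.base i a w) := by
  set l : A i → ℝ := fun a => min (endDist e (Φ.base i a 0)) (endDist e (Φ.base i a 1)) with hl
  have hnonneg : ∀ a, ∀ x ∈ Icc (0 : ℝ) 1, 0 ≤ endDist e (Φ.base i a x) := fun a x hx =>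
    endDist_nonneg (hV.2.2.2 i a x hx)
  have hzero : ∀ a, l a ≤ 0 → ∃ x : ℝ, (x = 0 ∨ x = 1) ∧ endDist e (Φ.base i a x) = 0 := by
    intro a h
    rcases min_le_iff.1 h with h | h
    · exact ⟨0, Or.inl rfl, h.antisymm (hnonneg a 0 (by simp))⟩
    · exact ⟨1, Or.inr rfl, h.antisymm (hnonneg a 1 (by simp))⟩
  have hlow : ∀ a, ∀ w ∈ Icc (0 : ℝ) 1, l a ≤ endDist e (Φ.base i a w) := by
    intro a w hw
    have h1 : l a ≤ endDist e (Φ.base i a 0) := min_le_left _ _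
    have h2 : l a ≤ endDist e (Φ.base i a 1) := min_le_right _ _
    have h3 : endDist e (Φ.base i a w)
        = (1 - w) * endDist e (Φ.base i a 0) + w * endDist e (Φ.base i a 1) := by
      cases e <;> simp only [endDist, base, cond_true, cond_false] <;> ring
    rw [h3]
    nlinarith [hw.1, hw.2, mul_le_mul_of_nonneg_left h1 (sub_nonneg.2 hw.2),
      mul_le_mul_of_nonneg_left h2 hw.1]
  obtain ⟨a₀, ha₀⟩ : ∃ a₀ : A i, ∀ a ≠ a₀, 0 < l a := by
    by_cases h : ∃ a₀, l a₀ ≤ 0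
    · obtain ⟨a₀, h0⟩ := h
      refine ⟨a₀, fun a ha => ?_⟩
      by_contra! h1
      obtain ⟨x, hx, hx0⟩ := hzero a₀ h0
      obtain ⟨y, hy, hy0⟩ := hzero a h1
      exact lt_asymm (hB.endDist_half_lt hV ha.symm hx hx0) (hB.endDist_half_lt hV ha hy hy0)
    · obtain ⟨s, -⟩ := hV.1
      exact ⟨s i, fun a _ => not_le.1 fun ha => h ⟨a, ha⟩⟩
  obtain ⟨κ, hκ, hκl⟩ := exists_pos_forall_le (fun a : {a // a ≠ a₀} => l a.1)
    fun a => ha₀ a.1 a.2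
  exact ⟨κ, hκ, a₀, fun a ha w hw => (hκl ⟨a, ha⟩).trans (hlow a w hw)⟩

/-- The coding of a word is far from the boundary if it departs early from the codes of the
endpoints. -/
theorem Baranski.exists_le_edgeDist (hV : Φ.Valid) (hB : Φ.Baranski) {M : ℝ} (hM : 0 < M)
    (hmM : ∀ i a, -Real.log |Φ.slope i a| ≤ M) (i : Fin d) :
    ∃ κ > 0, ∃ s : Bool → ℕ → A i, ∀ (ω : ℕ → Φ.Symb) (L : ℕ),
      (∀ e, ∃ n < L, (ω n).1 i ≠ s e n) → κ * Real.exp (-(M * L)) ≤ edgeDist (Φ.coding ω i) := by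
  choose κ hκ f hf using hB.exists_forall_ne_le_endDist hV i
  choose g hg using fun e => hV.mul_endDist_le i (f e) e
  have key : ∀ (L : ℕ) (e : Bool) (ω : ℕ → Φ.Symb), (∃ n < L, (ω n).1 i ≠ f (g^[n] e)) →
      min (κ false) (κ true) * Real.exp (-(M * L)) ≤ endDist e (Φ.coding ω i) := by
    intro L
    have hκ0 : 0 < min (κ false) (κ true) := lt_min (hκ _) (hκ _)
    induction L with
    | zero => intro e ω h; simp at h
    | succ L ih =>
      intro e ω h
      rw [hV.coding_eq_base ω]
      by_cases h0 : (ω 0).1 i = f e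
      · obtain ⟨n, hn, hne⟩ := h
        rcases n with _ | n
        · exact absurd h0 hne
        have h1 := ih (g e) (shift ω) ⟨n, Nat.lt_of_succ_lt_succ hn, hne⟩
        rw [h0]
        refine le_trans ?_ (hg e _)
        have h2 : Real.exp (-M) ≤ |Φ.slope i (f e)| := by
          rw [← Real.exp_log (abs_pos.2 (hV.2.1 i (f e)))]
          exact Real.exp_le_exp.2 (by linarith [hmM i (f e)])
        calc _ = Real.exp (-M) * (min (κ false) (κ true) * Real.exp (-(M * L))) := by
              rw [mul_left_comm, ← Real.exp_add]; push_cast; ring_nf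
          _ ≤ _ := mul_le_mul h2 h1 (by positivity) (abs_nonneg _)
      · refine le_trans ?_ (hf e _ h0 _ (hV.coding_mem_Icc _ i))
        refine (mul_le_of_le_one_right hκ0.le (Real.exp_le_one_iff.2 ?_)).trans ?_
        · exact neg_nonpos.2 (by positivity)
        · cases e
          · exact min_le_left _ _
          · exact min_le_right _ _
  exact ⟨_, lt_min (hκ false) (hκ true), fun e n => f (g^[n] e), fun ω L h =>
    le_min (key L false ω (h false)) (key L true ω (h true))⟩

end DiagIFS

theorem MulPeriodic.exists_mul_le_sum_window {lam : ℝ} {G : ℝ → ℝ} (h : MulPeriodic lam G)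
    (hl : 1 < lam) (h0 : ∀ b > 0, 0 ≤ G b) (hdense : Ioi (0 : ℝ) ⊆ closure {b | 0 < b ∧ 0 < G b})
    {ε : ℝ} (hε : 0 < ε) :
    ∃ c > 0, ∀ᶠ N : ℕ in atTop, c * N ≤ ∑ n ∈ Finset.range ⌈ε * N⌉₊, G ((N + n : ℕ) + 1) := by
  obtain ⟨c, hc, hcx⟩ := h.exists_mul_le_integral_window hl h0 hdense hε
  set η : ℝ := c / (4 * (2 + ε)) with hη
  have hη0 : 0 < η := by positivity
  have hev := eventually_forall_abs_le_of_tendsto_div (by simp) (h.tendsto_sum_sub_integral_div hl)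
    hη0
  have hK : Tendsto (fun N : ℕ => N + ⌈ε * N⌉₊) atTop atTop :=
    tendsto_atTop_mono (fun N => Nat.le_add_right _ _) tendsto_id
  refine ⟨c / 2, by positivity, ?_⟩
  filter_upwards [hK.eventually hev, eventually_ge_atTop 1] with N hN hN1
  have hN1' : (1 : ℝ) ≤ N := by exact_mod_cast hN1
  have e1 := hN N (Nat.le_add_right _ _)
  have e2 := hN _ le_rfl
  have e3 := hcx N hN1'
  have hceil := Nat.le_ceil (ε * N)
  have hceil' := Nat.ceil_lt_add_one (a := ε * N) (by positivity)
  set L := ⌈ε * N⌉₊ with hL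
  rw [Finset.sum_range_add] at e2
  have hN0 : (0 : ℝ) ≤ N := by positivity
  have hNL : (1 + ε) * N ≤ ((N + L : ℕ) : ℝ) := by push_cast; linarith
  have hint : ∫ b in (N : ℝ)..((1 + ε) * N), G b ≤ ∫ b in (N : ℝ)..((N + L : ℕ) : ℝ), G b := by
    refine intervalIntegral.integral_mono_interval le_rfl (by nlinarith) hNL ?_
      (h.intervalIntegrable hl hN0 (by positivity))
    exact (ae_restrict_mem measurableSet_Ioc).mono fun b hb =>
      h0 b (hN0.trans_lt hb.1)
  have hadd := intervalIntegral.integral_add_adjacent_intervals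
    (h.intervalIntegrable hl le_rfl hN0)
    (h.intervalIntegrable hl hN0 (show (0 : ℝ) ≤ ((N + L : ℕ) : ℝ) by positivity))
  have hKle : η * ((N + L : ℕ) : ℝ) ≤ c / 4 * N := by
    have : ((N + L : ℕ) : ℝ) ≤ (2 + ε) * N := by push_cast; linarith
    calc _ ≤ η * ((2 + ε) * N) := mul_le_mul_of_nonneg_left this hη0.le
      _ = _ := by rw [hη]; field_simp
  have e1' := (abs_le.1 e1).2
  have e2' := (abs_le.1 e2).1
  linarith

namespace Cycle

variable {Φ : DiagIFS d A} {c : Cycle Φ}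

theorem Nondeg.exists_lower_bound (h : c.Nondeg) : ∃ G : ℝ → ℝ, MulPeriodic c.lam G ∧
    (∀ b > 0, 0 ≤ G b) ∧ Ioi (0 : ℝ) ⊆ closure {b | 0 < b ∧ 0 < G b} ∧
      ∀ a, (∃ b' > 0, 0 < c.r b' a) → ∀ b > 0, G b ≤ c.r b a := by
  set F : Finset Φ.Symb := Finset.univ.filter fun a => ∃ b' > 0, 0 < c.r b' a with hF
  refine ⟨fun b => ∏ a ∈ F, c.r b a, c.mulPeriodic_comp (h := fun p => ∏ a ∈ F, p a)
    (by fun_prop), fun b hb => Finset.prod_nonneg fun a _ => (c.prob b hb).1 a, ?_, ?_⟩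
  · refine h.trans (closure_mono fun b hb => ⟨hb.1, Finset.prod_pos fun a ha => hb.2 a ?_⟩)
    simpa [hF] using ha
  · intro a ha b hb
    have haF : a ∈ F := by simpa [hF] using ha
    show ∏ a ∈ F, c.r b a ≤ _
    rw [← Finset.mul_prod_erase _ _ haF]
    refine mul_le_of_le_one_right ((c.prob b hb).1 a) ?_
    refine Finset.prod_le_one (fun a _ => (c.prob b hb).1 a) fun a' _ => ?_
    rw [← (c.prob b hb).2]
    exact Finset.single_le_sum (fun a _ => (c.prob b hb).1 a) (Finset.mem_univ a')

end Cycle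

namespace IsProductMeasure

variable {Φ : DiagIFS d A} {c : Cycle Φ} {μ : Measure (ℕ → Φ.Symb)}

/-- A nondegenerate pseudo-Bernoulli measure does not follow a prescribed sequence of symbols in a
nontrivial coordinate for long. -/
theorem ae_eventually_exists_ne (hμ : IsProductMeasure Φ (fun n => c.r (n + 1)) μ)
    (hl : 1 < c.lam) (hnd : c.Nondeg) {i : Fin d}
    (hi : ∃ a b : Φ.Symb, (∃ b' > 0, 0 < c.r b' a) ∧ (∃ b' > 0, 0 < c.r b' b) ∧ a.1 i ≠ b.1 i)
    (s : ℕ → A i) {ε : ℝ} (hε : 0 < ε) :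
    ∀ᵐ ω ∂μ, ∀ᶠ N : ℕ in atTop, ∃ n < ⌈ε * N⌉₊, (ω (N + n)).1 i ≠ s n := by
  have := hμ.1
  have hq : ∀ n : ℕ, IsProbVec (c.r (n + 1)) := fun n => c.prob _ (by positivity)
  obtain ⟨G, hG, hG0, hGd, hGle⟩ := hnd.exists_lower_bound
  obtain ⟨κ, hκ, hev⟩ := hG.exists_mul_le_sum_window hl hG0 hGd hε
  have hstep : ∀ (n : ℕ) (x : A i),
      ∑ a ∈ Finset.univ.filter (fun a : Φ.Symb => a.1 i = x), c.r (n + 1) a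
        ≤ 1 - G (n + 1) := by
    intro n x
    obtain ⟨a, ha, hax⟩ : ∃ a : Φ.Symb, (∃ b' > 0, 0 < c.r b' a) ∧ a.1 i ≠ x := by
      obtain ⟨a, b, ha, hb, hab⟩ := hi
      by_cases hx : a.1 i = x
      · exact ⟨b, hb, fun h => hab (hx.trans h.symm)⟩
      · exact ⟨a, ha, hx⟩
    have h1 := hGle a ha (n + 1) (by positivity)
    have h2 : ∑ b ∈ insert a (Finset.univ.filter (fun b : Φ.Symb => b.1 i = x)), c.r (n + 1) b
        ≤ 1 :=
      (Finset.sum_le_sum_of_subset_of_nonneg (Finset.subset_univ _)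
        fun b _ _ => (hq n).1 b).trans_eq (hq n).2
    rw [Finset.sum_insert (by simpa using hax)] at h2
    linarith
  have hmass : ∀ N : ℕ, μ.real {ω | ∀ n < ⌈ε * N⌉₊, (ω (N + n)).1 i = s n}
      ≤ Real.exp (-∑ n ∈ Finset.range ⌈ε * N⌉₊, G ((N + n : ℕ) + 1)) := by
    intro N
    have hset : {ω : ℕ → Φ.Symb | ∀ n < ⌈ε * N⌉₊, (ω (N + n)).1 i = s n}
        = {ω | ∀ k ∈ (Finset.range ⌈ε * N⌉₊).map (addLeftEmbedding N), ω k ∈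
          (Finset.univ.filter fun a : Φ.Symb => a.1 i = s (k - N))} := by
      ext ω
      simp
    rw [hset, hμ.real_box hq, Finset.prod_map, ← Finset.sum_neg_distrib, Real.exp_sum]
    refine Finset.prod_le_prod (fun n _ => Finset.sum_nonneg fun a _ => (hq _).1 a) fun n _ => ?_
    refine (hstep _ _).trans ?_
    simpa using Real.one_sub_le_exp_neg (G ((N + n : ℕ) + 1))
  have hsum : Summable fun N : ℕ => μ.real {ω | ∀ n < ⌈ε * N⌉₊, (ω (N + n)).1 i = s n} := by
    have hgeo := summable_geometric_of_lt_one (Real.exp_pos (-κ)).le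
      (Real.exp_lt_one_iff.2 (neg_lt_zero.2 hκ))
    refine Summable.of_norm_bounded_eventually_nat hgeo ?_
    filter_upwards [hev] with N hN
    rw [Real.norm_of_nonneg measureReal_nonneg, ← Real.exp_nat_mul]
    exact (hmass N).trans (Real.exp_le_exp.2 (by linarith))
  have hfin := hsum.tsum_ofReal_ne_top
  rw [tsum_congr fun N => ofReal_measureReal (measure_ne_top μ _)] at hfin
  filter_upwards [ae_eventually_notMem hfin] with ω hω
  simpa using hω

end IsProductMeasure

/-- Under a continuous map from a compact metrizable space, almost sure properties push
forward to the image measure, without any measurability assumption on the property. -/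
theorem ae_map_of_ae_of_continuous {X Y : Type*} [TopologicalSpace X] [CompactSpace X]
    [TopologicalSpace.MetrizableSpace X] [MeasurableSpace X] [BorelSpace X]
    [TopologicalSpace Y] [T2Space Y] [MeasurableSpace Y] [BorelSpace Y] {μ : Measure X}
    [IsFiniteMeasure μ] {f : X → Y} (hf : Continuous f)
    {p : Y → Prop} (h : ∀ᵐ x ∂μ, p (f x)) : ∀ᵐ y ∂(Measure.map f μ), p y := by
  obtain ⟨t, hts, htm, ht0⟩ := exists_measurable_superset_of_null (ae_iff.1 h)
  rw [ae_iff]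
  refine le_antisymm (ENNReal.le_of_forall_pos_le_add fun η hη _ => ?_) zero_le
  obtain ⟨K, hKt, hKcl, hKm⟩ := htm.compl.exists_isClosed_lt_add (measure_ne_top μ _)
    (ENNReal.coe_pos.2 hη).ne'
  have hK := hKcl.isCompact
  have hKc : IsClosed (f '' K) := (hK.image hf).isClosed
  calc Measure.map f μ {y | ¬ p y} ≤ Measure.map f μ (f '' K)ᶜ := by
        refine measure_mono fun y hy => ?_
        rintro ⟨x, hx, rfl⟩
        exact hKt hx (hts hy)
    _ = μ (f ⁻¹' (f '' K)ᶜ) := Measure.map_apply hf.measurable hKc.measurableSet.compl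
    _ ≤ μ Kᶜ := measure_mono fun x hx hxK => hx ⟨x, hxK, rfl⟩
    _ ≤ μ (tᶜ \ K) + μ t := by
        refine (measure_mono fun x hx => ?_).trans (measure_union_le _ _)
        by_cases hxt : x ∈ t
        · exact Or.inr hxt
        · exact Or.inl ⟨hxt, hx⟩
    _ ≤ 0 + η := by
        rw [ht0, add_zero, zero_add, measure_sdiff hKt hK.measurableSet.nullMeasurableSet
          hK.measure_ne_top]
        exact tsub_le_iff_left.2 hKm.le

theorem iterate_shift_apply {α : Type*} (N : ℕ) (ω : ℕ → α) (n : ℕ) :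
    shift^[N] ω n = ω (N + n) := by
  induction N generalizing ω with
  | zero => simp
  | succ N ih => rw [Function.iterate_succ_apply, ih, shift, Nat.add_right_comm]

namespace DiagIFS

variable {Φ : DiagIFS d A}

theorem logSize_le_mul {M : ℝ} (hM : ∀ i a, -Real.log |Φ.slope i a| ≤ M) (ω : ℕ → Φ.Symb)
    (i : Fin d) (N : ℕ) : Φ.logSize ω i N ≤ M * N := by
  have := Finset.sum_le_sum fun n (_ : n ∈ Finset.range N) => hM i ((ω n).1 i)
  simpa [logSize, mul_comm] using this

theorem Valid.tendsto_cutoff (hV : Φ.Valid) (ω : ℕ → Φ.Symb) (i : Fin d) :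
    Tendsto (fun B => Φ.cutoff ω B i) atTop atTop := by
  obtain ⟨m, M, hm, hM, hmM⟩ := hV.exists_rate_bounds
  refine tendsto_natCast_atTop_iff.1 (tendsto_atTop_mono' (f₁ := fun B : ℝ => B / M) _ ?_
    (tendsto_id.atTop_div_const hM) : Tendsto (fun B => (Φ.cutoff ω B i : ℝ)) atTop atTop)
  filter_upwards [eventually_ge_atTop 0] with B hB
  rw [div_le_iff₀' hM]
  exact (cutoff_spec hm hM hmM ω hB i).1.trans (logSize_le_mul (fun i a => (hmM i a).2) ω i _)

end DiagIFS

namespace IsProductMeasure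

section

variable {Φ : DiagIFS d A} {q : ℕ → Φ.Symb → ℝ} {μ : Measure (ℕ → Φ.Symb)}

theorem exp_neg_squareInfo_le (hμ : IsProductMeasure Φ q μ) (hq : ∀ n, IsProbVec (q n))
    (hV : Φ.Valid) {ω : ℕ → Φ.Symb} (hω : ∀ n, 0 < q n (ω n)) {B ρ : ℝ} (hB : 0 ≤ B)
    (hρ : Real.exp (-B) < ρ) : Real.exp (-Φ.squareInfo q (Φ.cutoff ω B) ω)
      ≤ (Measure.map Φ.coding μ).real (ball (Φ.coding ω) ρ) := by
  have := hμ.1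
  obtain ⟨m, M, hm, hM, hmM⟩ := hV.exists_rate_bounds
  rw [map_measureReal_apply hV.continuous_coding.measurable measurableSet_ball,
    ← hμ.real_square hq _ hω]
  refine measureReal_mono fun τ hτ => ?_
  refine mem_ball.2 ((dist_pi_lt_iff ((Real.exp_pos _).trans hρ)).2 fun i => ?_)
  refine lt_of_le_of_lt ?_ hρ
  rw [Real.dist_eq]
  refine (hV.abs_coding_sub_le (hτ i)).trans (Real.exp_le_exp.2 (neg_le_neg ?_))
  exact (DiagIFS.cutoff_spec hm hM hmM ω hB i).1

end

variable {Φ : DiagIFS d A} {c : Cycle Φ} {μ : Measure (ℕ → Φ.Symb)}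

theorem ae_eventually_eq_of_abs_coding_sub_lt (hμ : IsProductMeasure Φ (fun n => c.r (n + 1)) μ)
    (hl : 1 < c.lam) (hnd : c.Nondeg) (hV : Φ.Valid) (hB : Φ.Baranski) {i : Fin d}
    (hi : ∃ a b : Φ.Symb, (∃ b' > 0, 0 < c.r b' a) ∧ (∃ b' > 0, 0 < c.r b' b) ∧ a.1 i ≠ b.1 i)
    {ε : ℝ} (hε : 0 < ε) :
    ∀ᵐ ω ∂μ, ∀ᶠ B : ℝ in atTop, ∀ τ : ℕ → Φ.Symb,
      |Φ.coding τ i - Φ.coding ω i| < Real.exp (-((1 + ε) * B)) →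
        ∀ n < Φ.cutoff ω B i, (τ n).1 i = (ω n).1 i := by
  obtain ⟨m, M, hm, hM, hmM⟩ := hV.exists_rate_bounds
  obtain ⟨κ, hκ, s, hs⟩ := hB.exists_le_edgeDist hV hM (fun i a => (hmM i a).2) i
  set ε' : ℝ := ε * m / (2 * M) with hε'
  have hε'0 : 0 < ε' := by positivity
  filter_upwards [hμ.ae_eventually_exists_ne hl hnd hi (s false) hε'0,
    hμ.ae_eventually_exists_ne hl hnd hi (s true) hε'0] with ω h1 h2
  filter_upwards [(hV.tendsto_cutoff ω i).eventually h1, (hV.tendsto_cutoff ω i).eventually h2,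
    eventually_ge_atTop 0,
    eventually_ge_atTop ((2 * M + ε * m / 2 - Real.log κ) * (2 / ε))] with B h1 h2 hB0 hBl τ hτ
  obtain ⟨-, h3, h4⟩ := DiagIFS.cutoff_spec hm hM hmM ω hB0 i
  set N := Φ.cutoff ω B i with hN
  set L := ⌈ε' * N⌉₊ with hL
  by_contra! hne
  have h5 := hB.le_abs_coding_sub hV hne
  have h6 := hs (shift^[N] ω) L fun e => by
    simp only [iterate_shift_apply]
    cases e
    · exact h1
    · exact h2
  have h7 := (mul_le_mul_of_nonneg_left h6 (Real.exp_pos (-Φ.logSize ω i N)).le).trans h5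
  refine absurd (h7.trans_lt hτ) (not_lt.2 ?_)
  rw [← Real.exp_log hκ, ← Real.exp_add, ← Real.exp_add, Real.exp_le_exp]
  have hNle : (N : ℝ) ≤ B / m + 1 :=
    (Nat.cast_le.2 h4).trans (Nat.ceil_lt_add_one (by positivity)).le
  have hLle : (L : ℝ) ≤ ε' * N + 1 := (Nat.ceil_lt_add_one (by positivity)).le
  have hML : M * L ≤ ε / 2 * B + ε * m / 2 + M := by
    calc M * L ≤ M * (ε' * (B / m + 1) + 1) := by gcongr; exact hLle.trans (by gcongr)
      _ = _ := by rw [hε']; field_simp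
  have hBl' : 2 * M + ε * m / 2 - Real.log κ ≤ ε / 2 * B := by
    rw [← mul_comm B, ← div_le_iff₀ (by positivity)]
    refine le_trans (le_of_eq ?_) hBl
    field_simp
  linarith

/-- Balls around typical points of a nondegenerate pseudo-Bernoulli measure are essentially
contained in approximate squares of comparable size. -/
theorem ae_eventually_real_ball_le (hμ : IsProductMeasure Φ (fun n => c.r (n + 1)) μ)
    (hl : 1 < c.lam) (hnd : c.Nondeg) (hV : Φ.Valid) (hB : Φ.Baranski) {ε : ℝ} (hε : 0 < ε) :
    ∀ᵐ ω ∂μ, ∀ᶠ B : ℝ in atTop,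
      (Measure.map Φ.coding μ).real (ball (Φ.coding ω) (Real.exp (-((1 + ε) * B))))
        ≤ Real.exp (-Φ.squareInfo (fun n => c.r (n + 1)) (Φ.cutoff ω B) ω) := by
  have := hμ.1
  have hq : ∀ n : ℕ, IsProbVec (c.r (n + 1)) := fun n => c.prob _ (by positivity)
  have hpos := hμ.ae_pos hq
  have hcoord : ∀ i, ∀ᵐ ω ∂μ, ∀ᶠ B : ℝ in atTop, ∀ τ : ℕ → Φ.Symb,
      (∀ n : ℕ, 0 < c.r (n + 1) (τ n)) →
      |Φ.coding τ i - Φ.coding ω i| < Real.exp (-((1 + ε) * B)) →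
        ∀ n < Φ.cutoff ω B i, (τ n).1 i = (ω n).1 i := by
    intro i
    by_cases hi : ∃ a b : Φ.Symb, (∃ b' > 0, 0 < c.r b' a) ∧ (∃ b' > 0, 0 < c.r b' b) ∧
        a.1 i ≠ b.1 i
    · filter_upwards [hμ.ae_eventually_eq_of_abs_coding_sub_lt hl hnd hV hB hi hε] with ω h
      exact h.mono fun B hB τ _ => hB τ
    · filter_upwards [hpos] with ω hω
      refine Eventually.of_forall fun B τ hτ _ n _ => ?_
      by_contra hne
      exact hi ⟨τ n, ω n, ⟨n + 1, by positivity, hτ n⟩, ⟨n + 1, by positivity, hω n⟩, hne⟩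
  filter_upwards [ae_all_iff.2 hcoord, hpos] with ω h hω
  filter_upwards [eventually_all.2 h] with B hB
  rw [map_measureReal_apply hV.continuous_coding.measurable measurableSet_ball,
    ← hμ.real_square hq _ hω]
  refine ENNReal.toReal_mono (measure_ne_top μ _) (measure_mono_ae ?_)
  filter_upwards [hpos] with τ hτ hball i
  refine hB i τ hτ ?_
  rw [← Real.dist_eq]
  exact (dist_le_pi_dist _ _ i).trans_lt hball

theorem ae_lowerPtDim_coding_le (hμ : IsProductMeasure Φ (fun n => c.r (n + 1)) μ)
    (hl : 1 < c.lam) (hV : Φ.Valid) {ε : ℝ} (hε : 0 < ε) :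
    ∀ᵐ ω ∂μ, lowerPtDim (Measure.map Φ.coding μ) (Φ.coding ω) ≤ ENNReal.ofReal (c.delta + ε) := by
  have := hμ.1
  have hq : ∀ n : ℕ, IsProbVec (c.r (n + 1)) := fun n => c.prob _ (by positivity)
  have hprob : IsProbabilityMeasure (Measure.map Φ.coding μ) :=
    Measure.isProbabilityMeasure_map hV.continuous_coding.measurable.aemeasurable
  obtain ⟨_, ⟨B₀, hB₀, rfl⟩, hδ⟩ : ∃ x ∈ deltaRB Φ c.r '' Ioi 0, x < c.delta + ε / 3 :=
    exists_lt_of_csInf_lt (nonempty_Ioi.image _) (by rw [← c.delta_eq hV]; linarith)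
  have hδ0 := c.delta_nonneg hV
  filter_upwards [hμ.ae_pos hq, hμ.ae_forall_eventually_squareInfo hl hV] with ω hω hsq
  have hBk : Tendsto (fun k : ℕ => c.lam ^ k * B₀) atTop atTop :=
    (tendsto_pow_atTop_atTop_of_one_lt hl).atTop_mul_const hB₀
  have hρ : Tendsto (fun k : ℕ => 2 * Real.exp (-(c.lam ^ k * B₀))) atTop (𝓝[>] (0 : ℝ)) := by
    refine tendsto_nhdsWithin_iff.2 ⟨?_, Eventually.of_forall fun k => ?_⟩
    · simpa using ((Real.tendsto_exp_neg_atTop_nhds_zero.comp hBk).const_mul 2)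
    · exact mul_pos two_pos (Real.exp_pos _)
  refine liminf_le_of_frequently_le' (hρ.frequently (Eventually.frequently ?_))
  filter_upwards [hBk.eventually (hsq (ε / 3) (by positivity)), hBk.eventually_ge_atTop 1,
    hBk.eventually_ge_atTop ((c.delta + ε) * Real.log 2 / (ε / 3))] with k h1 hB1 hB2
  rw [c.deltaRB_lam_pow_mul hV k hB₀] at h1
  set B := c.lam ^ k * B₀ with hB
  have h2 := hμ.exp_neg_squareInfo_le hq hV hω (B := B) (ρ := 2 * Real.exp (-B))
    (by linarith) (by linarith [Real.exp_pos (-B)])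
  have h3 := Real.log_le_log (Real.exp_pos _) h2
  rw [Real.log_exp] at h3
  refine ENNReal.ofReal_le_ofReal ?_
  have hlog2 : Real.log 2 < 1 := by linarith [Real.log_two_lt_d9]
  have hlogρ : Real.log (2 * Real.exp (-B)) = Real.log 2 - B := by
    rw [Real.log_mul two_ne_zero (Real.exp_pos _).ne', Real.log_exp]; ring
  rw [hlogρ, ← neg_div_neg_eq, div_le_iff₀ (by linarith)]
  have h4 := (abs_le.1 h1).2
  have h5 : B * deltaRB Φ c.r B₀ ≤ B * (c.delta + ε / 3) :=
    mul_le_mul_of_nonneg_left hδ.le (by linarith)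
  rw [div_le_iff₀ (by positivity)] at hB2
  have h6 : -Φ.squareInfo (fun n => c.r (n + 1)) (Φ.cutoff ω B) ω ≤
    Real.log (Measure.map Φ.coding μ (ball (Φ.coding ω) (2 * Real.exp (-B)))).toReal := h3
  linarith

theorem ae_le_lowerPtDim_coding (hμ : IsProductMeasure Φ (fun n => c.r (n + 1)) μ)
    (hl : 1 < c.lam) (hnd : c.Nondeg) (hV : Φ.Valid) (hB : Φ.Baranski) {ε : ℝ} (hε : 0 < ε) :
    ∀ᵐ ω ∂μ, ENNReal.ofReal ((c.delta - ε) / (1 + ε))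
      ≤ lowerPtDim (Measure.map Φ.coding μ) (Φ.coding ω) := by
  have := hμ.1
  have hq : ∀ n : ℕ, IsProbVec (c.r (n + 1)) := fun n => c.prob _ (by positivity)
  filter_upwards [hμ.ae_pos hq, hμ.ae_forall_eventually_squareInfo hl hV,
    hμ.ae_eventually_real_ball_le hl hnd hV hB hε] with ω hω hsq hball
  have hlim : Tendsto (fun ρ : ℝ => -Real.log ρ / (1 + ε)) (𝓝[>] 0) atTop :=
    (tendsto_neg_atBot_atTop.comp Real.tendsto_log_nhdsGT_zero).atTop_div_const (by positivity)
  refine le_liminf_of_le (by isBoundedDefault) ?_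
  filter_upwards [hlim.eventually (hsq ε hε), hlim.eventually hball, hlim.eventually_gt_atTop 0,
    self_mem_nhdsWithin] with ρ h1 h2 hB0 hρ
  refine ENNReal.ofReal_le_ofReal ?_
  set B := -Real.log ρ / (1 + ε) with hBdef
  have hlogρ : Real.log ρ = -((1 + ε) * B) := by rw [hBdef]; field_simp
  rw [← hlogρ, Real.exp_log hρ] at h2
  have hpos : 0 < (Measure.map Φ.coding μ).real (ball (Φ.coding ω) ρ) := by
    refine (Real.exp_pos _).trans_le (hμ.exp_neg_squareInfo_le hq hV hω
      (B := (1 + ε) * B + 1) (by positivity) ?_)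
    rw [← Real.exp_log hρ, hlogρ, Real.exp_lt_exp]
    linarith
  have h3 := Real.log_le_log hpos h2
  rw [Real.log_exp] at h3
  have h4 := (abs_le.1 h1).1
  have h5 : B * c.delta ≤ B * deltaRB Φ c.r B :=
    mul_le_mul_of_nonneg_left (c.delta_le hV hB0) hB0.le
  rw [hlogρ, div_neg, ← neg_div, le_div_iff₀ (by positivity)]
  have h6 : Real.log (Measure.map Φ.coding μ (ball (Φ.coding ω) ρ)).toReal ≤
    -Φ.squareInfo (fun n => c.r (n + 1)) (Φ.cutoff ω B) ω := h3
  have h7 : (c.delta - ε) / (1 + ε) * ((1 + ε) * B) = B * c.delta - ε * B := by field_simp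
  linarith

theorem measDim_le (hμ : IsProductMeasure Φ (fun n => c.r (n + 1)) μ) (hV : Φ.Valid) :
    measDim (Measure.map Φ.coding μ) ≤ ENNReal.ofReal c.delta := by
  have := hμ.1
  obtain ⟨c', hl, hc'⟩ := c.exists_one_lt_lam
  have hδ : c'.delta = c.delta := by rw [c.delta_eq hV, c'.delta_eq hV, hc']
  have hlim : Tendsto (fun ε : ℝ => ENNReal.ofReal (c'.delta + ε)) (𝓝[>] 0)
      (𝓝 (ENNReal.ofReal c'.delta)) := by
    refine ENNReal.tendsto_ofReal (Tendsto.mono_left ?_ nhdsWithin_le_nhds)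
    simpa using (continuous_const.add continuous_id).tendsto (f := fun ε : ℝ => c'.delta + ε) 0
  rw [← hδ]
  refine ge_of_tendsto hlim ?_
  filter_upwards [self_mem_nhdsWithin] with ε hε
  refine essSup_le_of_ae_le _ (ae_map_of_ae_of_continuous hV.continuous_coding ?_)
  exact ae_lowerPtDim_coding_le (c := c') (by rwa [hc']) hl hV hε

theorem le_measDim (hμ : IsProductMeasure Φ (fun n => c.r (n + 1)) μ) (hnd : c.Nondeg)
    (hV : Φ.Valid) (hB : Φ.Baranski) :
    ENNReal.ofReal c.delta ≤ measDim (Measure.map Φ.coding μ) := by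
  have := hμ.1
  obtain ⟨c', hl, hc'⟩ := c.exists_one_lt_lam
  have hδ : c'.delta = c.delta := by rw [c.delta_eq hV, c'.delta_eq hV, hc']
  have hnd' : c'.Nondeg := by rw [Cycle.Nondeg, hc']; exact hnd
  have hlim : Tendsto (fun ε : ℝ => ENNReal.ofReal ((c'.delta - ε) / (1 + ε))) (𝓝[>] 0)
      (𝓝 (ENNReal.ofReal c'.delta)) := by
    refine ENNReal.tendsto_ofReal (Tendsto.mono_left ?_ nhdsWithin_le_nhds)
    have : ContinuousAt (fun ε : ℝ => (c'.delta - ε) / (1 + ε)) 0 :=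
      (by fun_prop : ContinuousAt (fun ε : ℝ => c'.delta - ε) 0).div (by fun_prop) (by norm_num)
    simpa [ContinuousAt] using this
  rw [← hδ]
  refine le_of_tendsto hlim ?_
  filter_upwards [self_mem_nhdsWithin] with ε hε
  have h1 := ae_le_lowerPtDim_coding (c := c') (by rwa [hc']) hl hnd' hV hB hε
  have h2 := ae_of_ae_map hV.continuous_coding.measurable.aemeasurable
    (ae_le_essSup (μ := Measure.map Φ.coding μ) (f := lowerPtDim (Measure.map Φ.coding μ)))
  obtain ⟨ω, h1, h2⟩ := (h1.and h2).exists
  exact h1.trans h2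

end IsProductMeasure

/-- The constant cycle at a probability vector. -/
def Cycle.const {Φ : DiagIFS d A} (p : Φ.Symb → ℝ) (hp : IsProbVec p) : Cycle Φ where
  lam := 1
  one_le_lam := le_rfl
  r _ := p
  prob _ _ := hp
  cont := continuousOn_const
  periodic _ _ := rfl
  const_of_lam_eq_one _ _ _ _ _ := rfl

namespace Cycle

variable {Φ : DiagIFS d A} {p : Φ.Symb → ℝ} (hp : IsProbVec p)

theorem nondeg_const : (Cycle.const p hp).Nondeg := by
  refine fun b hb => subset_closure ⟨hb, ?_⟩
  rintro a ⟨_, -, h⟩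
  exact h

theorem delta_const (hV : Φ.Valid) : (Cycle.const p hp).delta = deltaP Φ p := by
  obtain ⟨m, M, hm, hM, hmM⟩ := hV.exists_rate_bounds
  obtain ⟨c', hl, hc'⟩ := (Cycle.const p hp).exists_one_lt_lam
  have hcoord : ∀ i, Bcoord Φ (Cycle.const p hp).r 1 i = (Φ.chi i p)⁻¹ := by
    intro i
    have hpos : 0 < Φ.chi i p := hm.trans_le (Φ.chi_mem_Icc hmM i hp).1
    rw [← hc']
    refine c'.Bcoord_eq hl hV (inv_nonneg.2 hpos.le) ?_
    rw [hc']
    simp only [const, intervalIntegral.integral_const, smul_eq_mul, sub_zero]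
    exact inv_mul_cancel₀ hpos.ne'
  have h1 : (Cycle.const p hp).lam = 1 := rfl
  rw [delta, h1, Icc_self, image_singleton, csInf_singleton, deltaRB, inv_one, one_mul, deltaP]
  simp only [hcoord]
  rfl

end Cycle

/-- For a Barański sponge: the Hausdorff dimension of the pseudo-Bernoulli measure
`ν_r` of a nondegenerate cycle `r` equals `δ(r) = inf_{B∈[1,λ]} δ(r,B)`; in general
`HD(ν_r) ≤ δ(r)`; and in particular `HD(ν_p) = δ(p)` for every `p ∈ P`. -/
theorem pseudoBernoulli_dim_formula {d : ℕ} {A : Fin d → Type} [∀ i, Fintype (A i)]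
    (Φ : DiagIFS d A) (hV : Φ.Valid) (hB : Φ.Baranski) :
    (∀ (c : Cycle Φ) (μ : Measure (ℕ → Φ.Symb)),
      IsProductMeasure Φ (fun n => c.r ((n : ℝ) + 1)) μ →
        (c.Nondeg → measDim (Measure.map Φ.coding μ) = ENNReal.ofReal c.delta) ∧
        measDim (Measure.map Φ.coding μ) ≤ ENNReal.ofReal c.delta) ∧
    (∀ p : Φ.Symb → ℝ, IsProbVec p → ∀ μ : Measure (ℕ → Φ.Symb),
      IsProductMeasure Φ (fun _ => p) μ →
        measDim (Measure.map Φ.coding μ) = ENNReal.ofReal (deltaP Φ p)) := by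
  refine ⟨fun c μ hμ => ⟨fun hnd => le_antisymm (hμ.measDim_le hV) (hμ.le_measDim hnd hV hB),
    hμ.measDim_le hV⟩, fun p hp μ hμ => ?_⟩
  have hμ' : IsProductMeasure Φ (fun n => (Cycle.const p hp).r (n + 1)) μ := hμ
  rw [← Cycle.delta_const hp hV]
  exact le_antisymm (hμ'.measDim_le hV) (hμ'.le_measDim (Cycle.nondeg_const hp) hV hB)

end SelfAffineSponge
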